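/- arXiv:1806.10691 — 5 statements merged into one kernel-verified Lean document; each statement's English description precedes it below -/
import Mathlib

section
/- If X is a nondegenerate continuum, then CB(X) is an F_{σδ}-subset of the hyperspace 2^X. -/
open Set Topology Metric

noncomputable section

/-- The hyperspace `2^X` of nonempty compact (= closed, for compact `X`) subsets of `X`,
with the Hausdorff metric. -/
abbrev Hyper (X : Type*) [MetricSpace X] := TopologicalSpace.NonemptyCompacts X

/-- `C(X)`: the subcontinua of `X`, i.e. the connected members of the hyperspace. -/
def CSet (X : Type*) [MetricSpace X] : Set (Hyper X) :=
  {A | IsConnected (A : Set X)}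

/-- `CB(X)`: proper subcontinua of `X` with connected boundary. -/
def CBSet (X : Type*) [MetricSpace X] : Set (Hyper X) :=
  {A | IsConnected (A : Set X) ∧ (A : Set X) ≠ Set.univ ∧
    IsConnected (frontier (A : Set X))}

/-- `S(X)`: the members of the hyperspace that separate `X`,
i.e. whose complement is disconnected. -/
def SepSet (X : Type*) [MetricSpace X] : Set (Hyper X) :=
  {A | ¬ IsPreconnected ((A : Set X)ᶜ)}

/-- A set is `F_σ` if it is a countable union of closed sets. -/
def IsFsigma {α : Type*} [TopologicalSpace α] (s : Set α) : Prop :=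
  ∃ F : ℕ → Set α, (∀ n, IsClosed (F n)) ∧ s = ⋃ n, F n

/-- A set is `F_σδ` if it is a countable intersection of `F_σ` sets. -/
def IsFsigmaDelta {α : Type*} [TopologicalSpace α] (s : Set α) : Prop :=
  ∃ F : ℕ → Set α, (∀ n, IsFsigma (F n)) ∧ s = ⋂ n, F n

/-- A set is in the class `D_2(F_σ)` if it is a difference of two `F_σ` sets. -/
def IsD2Fsigma {α : Type*} [TopologicalSpace α] (s : Set α) : Prop :=
  ∃ u v : Set α, IsFsigma u ∧ IsFsigma v ∧ s = u \ v

/-- `X` is unicoherent: the intersection of any two closed connected sets covering `X`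
is connected. -/
def Unicoherent (X : Type*) [TopologicalSpace X] : Prop :=
  ∀ A B : Set X, IsClosed A → IsClosed B → IsConnected A → IsConnected B →
    A ∪ B = Set.univ → IsConnected (A ∩ B)

/-- An arc: a subspace homeomorphic to `[0,1]`. -/
def IsArc {X : Type*} [TopologicalSpace X] (A : Set X) : Prop :=
  Nonempty (unitInterval ≃ₜ A)

/-- A free arc: an arc which becomes open after removing its two endpoints. -/
def IsFreeArc {X : Type*} [TopologicalSpace X] (A : Set X) : Prop :=
  ∃ h : unitInterval ≃ₜ A, IsOpen (A \ {((h 0 : A) : X), ((h 1 : A) : X)})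

/-- `Y` is π-`n`-Euclidean: it has a π-base consisting of open sets homeomorphic to `ℝⁿ`. -/
def PiEuclidean (Y : Type*) [TopologicalSpace Y] (n : ℕ) : Prop :=
  ∃ 𝓤 : Set (Set Y),
    (∀ U ∈ 𝓤, IsOpen U ∧ U.Nonempty ∧ Nonempty (U ≃ₜ (Fin n → ℝ))) ∧
    ∀ V : Set Y, IsOpen V → V.Nonempty → ∃ U ∈ 𝓤, U ⊆ V

/-- The Hilbert cube `I^∞ = [0,1]^ℕ`. -/
abbrev Iinf : Type := ℕ → unitInterval

/-- The pseudo-interior `(0,1)^∞` of the Hilbert cube. -/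
def pseudoInterior : Set Iinf := {t | ∀ k, 0 < (t k : ℝ) ∧ (t k : ℝ) < 1}

/-- The pseudo-boundary `∂(I^∞) = I^∞ \ (0,1)^∞` of the Hilbert cube. -/
def pseudoBoundary : Set Iinf := pseudoInteriorᶜ

/-- A `Z`-set in a (Hilbert cube) metric space `Q`: a closed set `A` such that for every
`ε > 0` the identity can be `ε`-approximated by a map avoiding `A`. -/
def IsZSet {Q : Type*} [MetricSpace Q] (A : Set Q) : Prop :=
  IsClosed A ∧ ∀ ε : ℝ, 0 < ε →
    ∃ f : Q → Q, Continuous f ∧ (∀ x, dist (f x) x < ε) ∧ ∀ x, f x ∉ A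

/-- A `σZ`-set: a countable union of `Z`-sets. -/
def IsSigmaZSet {Q : Type*} [MetricSpace Q] (A : Set Q) : Prop :=
  ∃ Z : ℕ → Set Q, (∀ n, IsZSet (Z n)) ∧ A = ⋃ n, Z n

/-- `A ⊆ Q` is strongly `𝓜`-universal (for a class `𝓜` of subsets of the Hilbert cube
`I^∞`): every embedding `f : I^∞ → Q` sending a compact set `K` onto a `Z`-set can be
approximated by an embedding `g` onto a `Z`-set which agrees with `f` on `K` and with
`g⁻¹(A) \ K = M \ K`. -/
def StronglyUniversal {Q : Type*} [MetricSpace Q] (𝓜 : Set (Set Iinf)) (A : Set Q) : Prop :=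
  ∀ M ∈ 𝓜, ∀ K : Set Iinf, IsCompact K →
    ∀ f : Iinf → Q, IsEmbedding f → IsZSet (f '' K) →
      ∀ ε : ℝ, 0 < ε →
        ∃ g : Iinf → Q, IsEmbedding g ∧ IsZSet (Set.range g) ∧
          (∀ x, dist (g x) (f x) < ε) ∧ (∀ x ∈ K, g x = f x) ∧
          g ⁻¹' A \ K = M \ K

/-- Lebesgue covering dimension `≤ n`: every open cover has an open refinement which
covers and such that each point lies in at most `n + 1` members. -/
def CoveringDimLE (α : Type*) [TopologicalSpace α] (n : ℕ) : Prop :=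
  ∀ 𝓤 : Set (Set α), (∀ U ∈ 𝓤, IsOpen U) → ⋃₀ 𝓤 = Set.univ →
    ∃ 𝓥 : Set (Set α), (∀ V ∈ 𝓥, IsOpen V) ∧ ⋃₀ 𝓥 = Set.univ ∧
      (∀ V ∈ 𝓥, ∃ U ∈ 𝓤, V ⊆ U) ∧
      ∀ (x : α) (s : Finset (Set α)), ↑s ⊆ 𝓥 → (∀ V ∈ s, x ∈ V) → s.card ≤ n + 1

/-- An indecomposable continuum: not the union of two proper subcontinua. -/
def IndecomposableCont (X : Type*) [TopologicalSpace X] : Prop :=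
  ¬ ∃ A B : Set X, IsClosed A ∧ IsClosed B ∧ IsConnected A ∧ IsConnected B ∧
    A ≠ Set.univ ∧ B ≠ Set.univ ∧ A ∪ B = Set.univ
lemma fsigma_of_compl_gdelta {α : Type*} [TopologicalSpace α] {s : Set α} (h : IsGδ sᶜ) :
    IsFsigma s := by
  obtain ⟨f, hf, he⟩ := isGδ_iff_eq_iInter_nat.1 h
  refine ⟨fun n => (f n)ᶜ, fun n => (hf n).isClosed_compl, ?_⟩
  rw [← compl_iInter, ← he, compl_compl]

lemma compl_gdelta_of_fsigma {α : Type*} [TopologicalSpace α] {s : Set α} (h : IsFsigma s) :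
    IsGδ sᶜ := by
  obtain ⟨f, hf, rfl⟩ := h
  rw [compl_iUnion]
  exact IsGδ.iInter_of_isOpen fun n => (hf n).isOpen_compl

lemma fsigma_of_open {α : Type*} [MetricSpace α] {s : Set α} (h : IsOpen s) : IsFsigma s :=
  fsigma_of_compl_gdelta h.isClosed_compl.isGδ

lemma fsigma_union {α : Type*} [TopologicalSpace α] {s t : Set α} (hs : IsFsigma s)
    (ht : IsFsigma t) : IsFsigma (s ∪ t) := by
  apply fsigma_of_compl_gdelta
  rw [compl_union]
  exact (compl_gdelta_of_fsigma hs).inter (compl_gdelta_of_fsigma ht)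

lemma fsd_of_fsigma {α : Type*} [TopologicalSpace α] {s : Set α} (hs : IsFsigma s) :
    IsFsigmaDelta s := ⟨fun _ => s, fun _ => hs, (iInter_const s).symm⟩

lemma fsd_gdelta_union {α : Type*} [MetricSpace α] {s t : Set α} (hs : IsGδ s)
    (ht : IsFsigma t) : IsFsigmaDelta (s ∪ t) := by
  obtain ⟨f, hf, rfl⟩ := isGδ_iff_eq_iInter_nat.1 hs
  exact ⟨fun n => f n ∪ t, fun n => fsigma_union (fsigma_of_open (hf n)) ht, iInter_union _ _⟩

lemma fsd_iInter {α ι : Type*} [TopologicalSpace α] [Countable ι] [Nonempty ι] {s : ι → Set α}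
    (hs : ∀ i, IsFsigmaDelta (s i)) : IsFsigmaDelta (⋂ i, s i) := by
  choose F hF he using hs
  obtain ⟨g, hg⟩ := exists_surjective_nat (ι × ℕ)
  refine ⟨fun n => F (g n).1 (g n).2, fun n => hF _ _, ?_⟩
  rw [hg.iInter_comp (fun p : ι × ℕ => F p.1 p.2)]
  ext x
  simp [he]

lemma fsd_inter {α : Type*} [TopologicalSpace α] {s t : Set α}
    (hs : IsFsigmaDelta s) (ht : IsFsigmaDelta t) : IsFsigmaDelta (s ∩ t) := by
  rw [inter_eq_iInter]
  apply fsd_iInter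
  rintro (_ | _) <;> assumption

section
variable {X : Type*} [MetricSpace X]

/-- open neighbourhood -/
def nbO (D : Hyper X) (r : ℝ) : Set X := {x | infDist x (D : Set X) < r}
/-- closed neighbourhood -/
def nbC (D : Hyper X) (r : ℝ) : Set X := {x | infDist x (D : Set X) ≤ r}

lemma isOpen_nbO (D : Hyper X) (r : ℝ) : IsOpen (nbO D r) :=
  isOpen_lt (continuous_infDist_pt _) continuous_const
lemma isClosed_nbC (D : Hyper X) (r : ℝ) : IsClosed (nbC D r) :=
  isClosed_le (continuous_infDist_pt _) continuous_const
lemma nbO_sub (D : Hyper X) (r : ℝ) : nbO D r ⊆ nbC D r := fun x h =>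
  le_of_lt (show infDist x (D : Set X) < r from h)

lemma infDist_hyper (x : X) (A B : Hyper X) :
    infDist x (A : Set X) ≤ infDist x (B : Set X) + dist A B := by
  have := (lipschitz_infDist_set x).dist_le_mul A B
  simp only [Real.dist_eq, NNReal.coe_one, one_mul] at this
  have := le_abs_self (infDist x (A : Set X) - infDist x (B : Set X))
  linarith

variable [CompactSpace X]

instance hyperSep : TopologicalSpace.SeparableSpace (Hyper X) := inferInstance

lemma conn_iff [Nonempty X] (C : Set X) (hC : IsClosed C) :
    IsPreconnected C ↔ ∀ p : ℕ × ℕ × ℕ,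
      Disjoint (nbC (TopologicalSpace.denseSeq (Hyper X) p.1) (1 / ((p.2.2 : ℝ) + 1)))
        (nbC (TopologicalSpace.denseSeq (Hyper X) p.2.1) (1 / ((p.2.2 : ℝ) + 1))) →
      ¬ Disjoint C (nbO (TopologicalSpace.denseSeq (Hyper X) p.1) (1 / ((p.2.2 : ℝ) + 1)) ∪
        nbO (TopologicalSpace.denseSeq (Hyper X) p.2.1) (1 / ((p.2.2 : ℝ) + 1)))ᶜ ∨
      (Disjoint C (nbC (TopologicalSpace.denseSeq (Hyper X) p.1) (1 / ((p.2.2 : ℝ) + 1))) ∨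
      Disjoint C (nbC (TopologicalSpace.denseSeq (Hyper X) p.2.1) (1 / ((p.2.2 : ℝ) + 1)))) := by
  constructor
  · rintro h ⟨n, m, k⟩ hd
    simp only at hd ⊢
    by_contra! hcon
    obtain ⟨h1, h2, h3⟩ := hcon
    rw [disjoint_compl_right_iff_subset] at h1
    rw [not_disjoint_iff_nonempty_inter] at h2 h3
    obtain ⟨x, hx, hx'⟩ := (isPreconnected_closed_iff.1 h) _ _ (isClosed_nbC _ _)
      (isClosed_nbC _ _) (h1.trans (union_subset_union (nbO_sub _ _) (nbO_sub _ _))) h2 h3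
    exact disjoint_left.1 hd hx'.1 hx'.2
  · intro h
    rw [isPreconnected_closed_iff]
    intro S T hS hT hsub hCS hCT
    by_contra hne
    have hdis : Disjoint (C ∩ S) (C ∩ T) := by
      rw [disjoint_left]
      exact fun x h1 h2 => hne ⟨x, h1.1, h1.2, h2.2⟩
    obtain ⟨δ, hδ, hδd⟩ := hdis.exists_thickenings (hC.inter hS).isCompact (hC.inter hT)
    obtain ⟨k, hk⟩ := exists_nat_one_div_lt (half_pos hδ)
    set r : ℝ := 1 / ((k : ℝ) + 1) with hr
    have hr0 : 0 < r := by positivity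
    let P : Hyper X := ⟨⟨C ∩ S, (hC.inter hS).isCompact⟩, hCS⟩
    let Q : Hyper X := ⟨⟨C ∩ T, (hC.inter hT).isCompact⟩, hCT⟩
    obtain ⟨n, hn⟩ := (TopologicalSpace.denseRange_denseSeq (Hyper X)).exists_dist_lt P hr0
    obtain ⟨m, hm⟩ := (TopologicalSpace.denseRange_denseSeq (Hyper X)).exists_dist_lt Q hr0
    have hh := h (n, m, k)
    simp only [← hr] at hh
    generalize TopologicalSpace.denseSeq (Hyper X) n = D at *
    generalize TopologicalSpace.denseSeq (Hyper X) m = E at *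
    have key : ∀ (R F : Hyper X), dist R F < r →
        (R : Set X) ⊆ nbO F r ∧ nbC F r ⊆ thickening δ (R : Set X) := by
      intro R F hRF
      constructor
      · intro x hx
        have := infDist_hyper x F R
        rw [infDist_zero_of_mem hx, dist_comm] at this
        show infDist x (F : Set X) < r
        linarith
      · intro x hx
        rw [mem_thickening_iff_infDist_lt R.nonempty]
        have := infDist_hyper x R F
        have hx : infDist x (F : Set X) ≤ r := hx
        linarith
    obtain ⟨a1, a2⟩ := key P D hn
    obtain ⟨b1, b2⟩ := key Q E hm
    rcases hh (hδd.mono a2 b2) with h1 | h1 | h1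
    · apply h1
      rw [disjoint_compl_right_iff_subset]
      intro x hx
      rcases hsub hx with hs | ht
      · exact Or.inl (a1 ⟨hx, hs⟩)
      · exact Or.inr (b1 ⟨hx, ht⟩)
    · obtain ⟨x, hx⟩ := hCS
      exact disjoint_left.1 h1 hx.1 (nbO_sub _ _ (a1 hx))
    · obtain ⟨x, hx⟩ := hCT
      exact disjoint_left.1 h1 hx.1 (nbO_sub _ _ (b1 hx))

/-- General principle: a set-valued map avoiding closed sets in an F-sigma way. -/
lemma fsd_conn [Nonempty X] (f : Hyper X → Set X) (hf : ∀ A, IsClosed (f A))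
    (hd : ∀ K : Set X, IsClosed K → IsFsigma {A | Disjoint (f A) K}) :
    IsFsigmaDelta {A | IsPreconnected (f A)} := by
  simp_rw [fun A => conn_iff (f A) (hf A)]
  rw [ofPred_forall]
  apply fsd_iInter
  rintro p
  by_cases hp : Disjoint
      (nbC (TopologicalSpace.denseSeq (Hyper X) p.1) (1 / ((p.2.2 : ℝ) + 1)))
        (nbC (TopologicalSpace.denseSeq (Hyper X) p.2.1) (1 / ((p.2.2 : ℝ) + 1)))
  · simp only [hp, true_imp_iff, ofPred_true, iInter_true]
    refine fsd_gdelta_union (compl_gdelta_of_fsigma (hd _ ?_)) (fsigma_union (hd _ ?_) (hd _ ?_))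
    · exact ((isOpen_nbO _ _).union (isOpen_nbO _ _)).isClosed_compl
    · exact isClosed_nbC _ _
    · exact isClosed_nbC _ _
  · simp only [hp, false_imp_iff, ofPred_true]
    exact fsd_of_fsigma (fsigma_of_open isOpen_univ)

lemma fsigma_id (K : Set X) (hK : IsClosed K) : IsFsigma {A : Hyper X | Disjoint (A : Set X) K} := by
  apply fsigma_of_open
  simp_rw [← subset_compl_iff_disjoint_right]
  exact TopologicalSpace.NonemptyCompacts.isOpen_subsets_of_isOpen hK.isOpen_compl

lemma cont_infDist (x : X) : Continuous fun A : Hyper X => infDist x (A : Set X) :=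
  (lipschitz_infDist_set x).continuous

lemma closed_mem (x : X) : IsClosed {A : Hyper X | x ∈ (A : Set X)} := by
  have : {A : Hyper X | x ∈ (A : Set X)} = {A : Hyper X | infDist x (A : Set X) = 0} := by
    ext A
    exact A.isCompact.isClosed.mem_iff_infDist_zero A.nonempty
  rw [this]
  exact isClosed_eq (cont_infDist x) continuous_const

lemma fsigma_frontier (K : Set X) (hK : IsClosed K) :
    IsFsigma {A : Hyper X | Disjoint (frontier (A : Set X)) K} := by
  refine ⟨fun n => ⋂ x ∈ K, ({A : Hyper X | 1 / ((n : ℝ) + 1) ≤ infDist x (A : Set X)} ∪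
      ⋂ y ∈ ball x (1 / ((n : ℝ) + 1)), {A : Hyper X | y ∈ (A : Set X)}), ?_, ?_⟩
  · intro n
    refine isClosed_biInter fun x _ => IsClosed.union ?_ (isClosed_biInter fun y _ => closed_mem y)
    exact isClosed_le continuous_const (cont_infDist x)
  · ext A
    simp only [mem_ofPred_eq, mem_iUnion, mem_iInter, mem_union]
    have hA : IsClosed (A : Set X) := A.isCompact.isClosed
    constructor
    · intro h
      obtain ⟨δ, hδ, hb⟩ := lebesgue_number_lemma_of_metric (s := K)
        (c := fun b : Bool => cond b (interior (A : Set X)) (A : Set X)ᶜ) hK.isCompact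
        (by rintro (_ | _); exacts [hA.isOpen_compl, isOpen_interior])
        (by
          intro x hx
          rw [mem_iUnion]
          by_cases hxA : x ∈ (A : Set X)
          · refine ⟨true, ?_⟩
            by_contra hxi
            refine disjoint_left.1 h ?_ hx
            rw [hA.frontier_eq]
            exact ⟨hxA, hxi⟩
          · exact ⟨false, hxA⟩)
      obtain ⟨n, hn⟩ := exists_nat_one_div_lt hδ
      refine ⟨n, fun x hx => ?_⟩
      obtain ⟨b, hb⟩ := hb x hx
      cases b
      · left
        rw [le_infDist A.nonempty]
        intro y hy
        by_contra! hlt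
        exact hb (mem_ball'.2 (hlt.trans hn)) hy
      · right
        intro y hy
        exact interior_subset (hb (ball_subset_ball hn.le hy))
    · rintro ⟨n, hn⟩
      rw [disjoint_left]
      intro x hx hxK
      rw [hA.frontier_eq] at hx
      have hpos : 0 < 1 / ((n : ℝ) + 1) := by positivity
      rcases hn x hxK with h | h
      · rw [infDist_zero_of_mem hx.1] at h
        linarith
      · exact hx.2 (mem_interior.2 ⟨_, h, isOpen_ball, mem_ball_self hpos⟩)

end

/-- If `X` is a nondegenerate continuum, then `CB(X)` is an
`F_σδ`-subset of the hyperspace `2^X`. -/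
theorem CBSet_isFsigmaDelta (X : Type*) [MetricSpace X] [CompactSpace X]
    [ConnectedSpace X] [Nontrivial X] :
    IsFsigmaDelta (CBSet X) := by
  have e : CBSet X = {A : Hyper X | IsPreconnected (A : Set X)} ∩
      ({A : Hyper X | (A : Set X) ≠ univ} ∩
        {A : Hyper X | IsPreconnected (frontier (A : Set X))}) := by
    ext A
    constructor
    · rintro ⟨h1, h2, h3⟩
      exact ⟨h1.2, h2, h3.2⟩
    · rintro ⟨h1, h2, h3⟩
      refine ⟨⟨A.nonempty, h1⟩, h2, ?_, h3⟩
      exact nonempty_frontier_iff.2 ⟨A.nonempty, h2⟩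
  rw [e]
  refine fsd_inter (fsd_conn _ (fun A => A.isCompact.isClosed) fsigma_id)
    (fsd_inter (fsd_of_fsigma (fsigma_of_open ?_))
      (fsd_conn _ (fun A => isClosed_frontier) fsigma_frontier))
  have : {A : Hyper X | (A : Set X) ≠ univ} = (⋂ x : X, {A : Hyper X | x ∈ (A : Set X)})ᶜ := by
    ext A
    simp [eq_univ_iff_forall]
  rw [this]
  exact (isClosed_iInter closed_mem).isOpen_compl
end
end

section
/- If X is a nondegenerate unicoherent continuum, then CB(X) = C(X) ∩ α^{-1}(C(X)), where α : 2^X \ {X} → 2^X is defined by α(A) = closure(X \ A); that is, a proper subcontinuum A of X has connected boundary if and only if closure(X \ A) is connected. -/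
open Set Topology Metric

noncomputable section

theorem clopen_aux {X : Type*} [TopologicalSpace X] [PreconnectedSpace X] {A t t' : Set X}
    (hA : IsClosed A) (hne : A.Nonempty) (ht : IsClosed t) (ht' : IsClosed t')
    (hc : closure Aᶜ ⊆ t ∪ t') (hn : (closure Aᶜ ∩ t').Nonempty)
    (hdis : ¬ (closure Aᶜ ∩ (t ∩ t')).Nonempty)
    (hF : A ∩ closure Aᶜ ⊆ t) : False := by
  have heq : closure Aᶜ ∩ t' = Aᶜ ∩ tᶜ := by
    ext x
    constructor
    · rintro ⟨h1, h2⟩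
      have h3 : x ∉ t := fun h => hdis ⟨x, h1, h, h2⟩
      exact ⟨fun hx => h3 (hF ⟨hx, h1⟩), h3⟩
    · rintro ⟨h1, h2⟩
      have h3 := subset_closure h1
      exact ⟨h3, (hc h3).resolve_left h2⟩
  have hclopen : IsClopen (closure Aᶜ ∩ t') :=
    ⟨isClosed_closure.inter ht', heq ▸ hA.isOpen_compl.inter ht.isOpen_compl⟩
  have hu := hclopen.eq_univ hn
  obtain ⟨a, ha⟩ := hne
  have : a ∈ Aᶜ ∩ tᶜ := heq ▸ hu ▸ mem_univ a
  exact this.1 ha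

theorem frontier_iff_aux {X : Type*} [TopologicalSpace X] [PreconnectedSpace X]
    (huc : Unicoherent X) {A : Set X} (hcl : IsClosed A) (hA : IsConnected A)
    (hne : A ≠ Set.univ) :
    IsConnected (frontier A) ↔ IsConnected (closure Aᶜ) := by
  have hfr : frontier A = A ∩ closure Aᶜ := by
    rw [frontier_eq_closure_inter_closure, hcl.closure_eq]
  rw [hfr]
  constructor
  · intro hF
    refine ⟨(nonempty_compl.2 hne).mono subset_closure, ?_⟩
    rw [isPreconnected_closed_iff]
    intro t t' ht ht' hc h1 h2
    by_contra hdis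
    have hdis' : ¬ (closure Aᶜ ∩ (t' ∩ t)).Nonempty := by rwa [inter_comm t' t]
    have hFc := isPreconnected_closed_iff.1 hF.isPreconnected t t' ht ht'
      (inter_subset_right.trans hc)
    by_cases h3 : (A ∩ closure Aᶜ ∩ t').Nonempty
    · have h4 : A ∩ closure Aᶜ ⊆ t' := by
        intro x hx
        refine (hc hx.2).resolve_left fun hxt => ?_
        obtain ⟨y, hy, hy'⟩ := hFc ⟨x, hx, hxt⟩ h3
        exact hdis ⟨y, hy.2, hy'⟩
      exact clopen_aux hcl hA.nonempty ht' ht (by rwa [union_comm]) h1 hdis' h4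
    · exact clopen_aux hcl hA.nonempty ht ht' hc h2 hdis
        fun x hx => (hc hx.2).resolve_right fun hxt => h3 ⟨x, hx, hxt⟩
  · intro hB
    refine huc A _ hcl isClosed_closure hA hB ?_
    refine eq_univ_of_univ_subset ?_
    rw [← union_compl_self A]
    exact union_subset_union_right _ subset_closure

/-- If `X` is a nondegenerate unicoherent continuum, then
`CB(X) = C(X) ∩ α⁻¹(C(X))` where `α(A) = closure (X \ A)`; that is, a proper
subcontinuum `A` of `X` has connected boundary iff `closure (X \ A)` is connected. -/
theorem CBSet_eq_preimage_closure_compl (X : Type*) [MetricSpace X] [CompactSpace X]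
    [ConnectedSpace X] [Nontrivial X] (huc : Unicoherent X) :
    CBSet X = {A : Hyper X | IsConnected (A : Set X) ∧ (A : Set X) ≠ Set.univ ∧
        IsConnected (closure ((A : Set X)ᶜ))} ∧
      ∀ A : Hyper X, IsConnected (A : Set X) → (A : Set X) ≠ Set.univ →
        (IsConnected (frontier (A : Set X)) ↔ IsConnected (closure ((A : Set X)ᶜ))) := by
  have key : ∀ A : Hyper X, IsConnected (A : Set X) → (A : Set X) ≠ Set.univ →
      (IsConnected (frontier (A : Set X)) ↔ IsConnected (closure ((A : Set X)ᶜ))) :=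
    fun A hA hne => frontier_iff_aux huc A.isCompact.isClosed hA hne
  refine ⟨?_, key⟩
  ext A
  exact and_congr_right fun hA => and_congr_right fun hne => key A hA hne
end
end

section
/- If X is a nondegenerate unicoherent continuum, then CB(X) is a G_δ-subset of C(X). -/
open Set Topology Metric

noncomputable section

/-- A countable family of open sets interpolating between compact sets and open sets. -/
theorem exists_countable_interp (X : Type*) [MetricSpace X] [CompactSpace X] :
    ∃ F : Set (Set X), F.Countable ∧
      ∀ K U : Set X, IsClosed K → IsOpen U → K ⊆ U → ∃ V ∈ F, K ⊆ V ∧ V ⊆ U := by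
  obtain ⟨B, hBc, -, hB⟩ := TopologicalSpace.exists_countable_basis X
  refine ⟨Set.sUnion '' {t | t.Finite ∧ t ⊆ B},
    (Set.countable_setOf_finite_subset hBc).image _, ?_⟩
  intro K U hK hU hKU
  obtain ⟨S, hSB, rfl⟩ := hB.open_eq_sUnion hU
  rw [sUnion_eq_biUnion] at hKU
  obtain ⟨T, hTS, hTf, hKT⟩ := hK.isCompact.elim_finite_subcover_image
    (b := S) (c := fun s => s) (fun s hs => hB.isOpen (hSB hs)) hKU
  refine ⟨⋃₀ T, ⟨T, ⟨hTf, hTS.trans hSB⟩, rfl⟩, ?_, sUnion_subset_sUnion hTS⟩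
  rwa [sUnion_eq_biUnion]

/-- In a unicoherent continuum, a proper subcontinuum has connected boundary iff the closure of
its complement is connected. -/
theorem frontier_connected_iff (X : Type*) [MetricSpace X] [CompactSpace X]
    [ConnectedSpace X] (huc : Unicoherent X) (A : Set X) (hAc : IsClosed A)
    (hA : IsConnected A) (hne : A ≠ univ) :
    IsConnected (frontier A) ↔ IsPreconnected (closure Aᶜ) := by
  have hfr : frontier A = A ∩ closure Aᶜ := by
    rw [frontier_eq_closure_inter_closure, hAc.closure_eq]
  have hcov : A ∪ closure Aᶜ = univ :=
    eq_univ_of_forall fun x => (em (x ∈ A)).imp id fun h => subset_closure h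
  constructor
  · intro h
    rw [isPreconnected_iff_subset_of_fully_disjoint_closed isClosed_closure]
    intro u v hu hv huv hd
    have key : ∀ u v : Set X, IsClosed u → IsClosed v → closure Aᶜ ⊆ u ∪ v → Disjoint u v →
        frontier A ⊆ u → closure Aᶜ ⊆ u := by
      intro u v hu hv huv hd hf
      have hpre := (isPreconnected_iff_subset_of_fully_disjoint_closed
        (isClosed_univ (X := X))).1 isPreconnected_univ (A ∪ u) (closure Aᶜ ∩ v)
        (hAc.union hu) (isClosed_closure.inter hv) ?_ ?_
      · rcases hpre with h1 | h1
        · intro x hx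
          rcases h1 (mem_univ x) with h2 | h2
          · exact hf (hfr ▸ ⟨h2, hx⟩)
          · exact h2
        · exfalso
          obtain ⟨a, ha⟩ := h.nonempty
          exact disjoint_left.1 hd (hf ha) (h1 (mem_univ a)).2
      · intro x _
        by_cases hx : x ∈ A
        · exact Or.inl (Or.inl hx)
        · rcases huv (subset_closure hx) with h2 | h2
          · exact Or.inl (Or.inr h2)
          · exact Or.inr ⟨subset_closure hx, h2⟩
      · rw [disjoint_left]
        rintro x (hx | hx) ⟨h1, h2⟩
        · exact disjoint_left.1 hd (hf (hfr ▸ ⟨hx, h1⟩)) h2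
        · exact disjoint_left.1 hd hx h2
    have hsub : frontier A ⊆ u ∪ v := by
      rw [hfr]; exact inter_subset_right.trans huv
    rcases (isPreconnected_iff_subset_of_fully_disjoint_closed isClosed_frontier).1
      h.isPreconnected u v hu hv hsub hd with h1 | h1
    · exact Or.inl (key u v hu hv huv hd h1)
    · exact Or.inr (key v u hv hu (by rwa [union_comm]) hd.symm h1)
  · intro h
    rw [hfr]
    refine huc A _ hAc isClosed_closure hA ⟨?_, h⟩ hcov
    exact (nonempty_compl.2 hne).closure

theorem isClosed_superset (X : Type*) [MetricSpace X] (S : Set X) :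
    IsClosed {A : Hyper X | S ⊆ (A : Set X)} := by
  have : {A : Hyper X | S ⊆ (A : Set X)} =
      ⋂ x ∈ S, {A : Hyper X | ((A : Set X) ∩ {x}).Nonempty} := by
    ext A
    simp [subset_def]
  rw [this]
  exact isClosed_biInter fun x _ =>
    TopologicalSpace.NonemptyCompacts.isClosed_inter_nonempty_of_isClosed isClosed_singleton

/-- If `X` is a nondegenerate unicoherent continuum, then `CB(X)` is a
`G_δ`-subset of `C(X)`. -/
theorem CBSet_isGdelta (X : Type*) [MetricSpace X] [CompactSpace X]
    [ConnectedSpace X] [Nontrivial X] (huc : Unicoherent X) :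
    IsGδ ((Subtype.val ⁻¹' CBSet X) : Set ↥(CSet X)) := by
  obtain ⟨F, hF, hFi⟩ := exists_countable_interp X
  have hcl : ∀ S : Set X, IsClosed {A : CSet X | S ⊆ ((A : Hyper X) : Set X)} := fun S =>
    (isClosed_superset X S).preimage continuous_subtype_val
  have heq : ((Subtype.val ⁻¹' CBSet X) : Set ↥(CSet X)) =
      {A : CSet X | univ ⊆ ((A : Hyper X) : Set X)}ᶜ ∩
      ⋂ p ∈ {p : Set X × Set X | p ∈ F ×ˢ F ∧ Disjoint (closure p.1) (closure p.2)},
        ({A : CSet X | (p.1 ∪ p.2)ᶜ ⊆ ((A : Hyper X) : Set X)}ᶜ ∪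
          ({A : CSet X | p.1 ⊆ ((A : Hyper X) : Set X)} ∪
            {A : CSet X | p.2 ⊆ ((A : Hyper X) : Set X)})) := by
    ext ⟨A, hA⟩
    have hA' : IsConnected (A : Set X) := hA
    have hAc : IsClosed (A : Set X) := A.isCompact.isClosed
    simp only [mem_preimage, CBSet, mem_setOf_eq, mem_inter_iff, mem_compl_iff, univ_subset_iff,
      mem_iInter, mem_union]
    constructor
    · rintro ⟨-, hne, hfr⟩
      refine ⟨hne, ?_⟩
      rw [frontier_connected_iff X huc _ hAc hA' hne] at hfr
      rintro ⟨U, V⟩ ⟨-, hd⟩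
      by_cases hsub : (U ∪ V)ᶜ ⊆ (A : Set X)
      · right
        have h1 : closure (A : Set X)ᶜ ⊆ closure U ∪ closure V := by
          rw [← closure_union]
          exact closure_mono (compl_subset_comm.1 hsub)
        rcases (isPreconnected_iff_subset_of_fully_disjoint_closed isClosed_closure).1 hfr _ _
          isClosed_closure isClosed_closure h1 hd with h2 | h2
        · right
          intro x hx
          by_contra hxA
          exact disjoint_left.1 hd (h2 (subset_closure hxA)) (subset_closure hx)
        · left
          intro x hx
          by_contra hxA
          exact disjoint_left.1 hd (subset_closure hx) (h2 (subset_closure hxA))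
      · exact Or.inl hsub
    · rintro ⟨hne, H⟩
      refine ⟨hA', hne, ?_⟩
      rw [frontier_connected_iff X huc _ hAc hA' hne,
        isPreconnected_iff_subset_of_fully_disjoint_closed isClosed_closure]
      intro u v hu hv huv hd
      obtain ⟨U1, hU1o, huU1, hU1v⟩ := normal_exists_closure_subset hu hv.isOpen_compl
        (subset_compl_iff_disjoint_right.2 hd)
      obtain ⟨V1, hV1o, hvV1, hV1U⟩ := normal_exists_closure_subset hv
        (isClosed_closure (s := U1)).isOpen_compl (subset_compl_comm.1 hU1v)
      obtain ⟨U, hUF, huU, hUU1⟩ := hFi u U1 hu hU1o huU1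
      obtain ⟨V, hVF, hvV, hVV1⟩ := hFi v V1 hv hV1o hvV1
      have hdUV : Disjoint (closure U) (closure V) :=
        (subset_compl_iff_disjoint_left.1 hV1U).mono (closure_mono hUU1) (closure_mono hVV1)
      rcases H (U, V) ⟨⟨hUF, hVF⟩, hdUV⟩ with h | h | h
      · exfalso
        exact h (compl_subset_comm.1
          (subset_closure.trans (huv.trans (union_subset_union huU hvV))))
      · right
        refine closure_minimal (fun x hx => ?_) hv
        rcases huv (subset_closure hx) with h1 | h1
        · exact absurd (h (huU h1)) hx
        · exact h1
      · left
        refine closure_minimal (fun x hx => ?_) hu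
        rcases huv (subset_closure hx) with h1 | h1
        · exact h1
        · exact absurd (h (hvV h1)) hx
  rw [heq]
  refine (hcl _).isOpen_compl.isGδ.inter (IsGδ.biInter ?_ fun p _ => ?_)
  · exact (hF.prod hF).mono fun p hp => hp.1
  · exact (hcl _).isOpen_compl.isGδ.union ((hcl _).isGδ.union (hcl _).isGδ)
end
end

section
/- If X is a nondegenerate unicoherent Peano continuum without free arcs which contains an open subset homeomorphic to ℝ^n for some n with 2 ≤ n < ∞, then C(X) \ CB(X) is F_σ-universal in C(X): for each F_σ-subset M of the Hilbert cube I^∞ there is an embedding φ : I^∞ → C(X) such that φ^{-1}(C(X) \ CB(X)) = M. -/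
open Set Topology Metric

noncomputable section

section Helpers

variable {E : Type*} [NormedAddCommGroup E] [NormedSpace ℝ E]

/-- A rotationally symmetric region with inner radius `f` and outer radius `R`. -/
def tubeSet (E : Type*) [NormedAddCommGroup E] (f R : ℝ → ℝ) : Set (ℝ × E) :=
  {p | 0 ≤ p.1 ∧ p.1 ≤ 1 ∧ f p.1 ≤ ‖p.2‖ ∧ ‖p.2‖ ≤ R p.1}

/-- Parametrization of the region. -/
def tubeMap (f R : ℝ → ℝ) (q : (ℝ × ℝ) × E) : ℝ × E :=
  (q.1.1, ((1 - q.1.2) * f q.1.1 + q.1.2 * R q.1.1) • q.2)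

/-- Center of the unit square. -/
def sqCenter : ℝ × ℝ := (1 / 2, 1 / 2)

lemma polar [Nontrivial E] (y : E) : ∃ u : E, ‖u‖ = 1 ∧ ‖y‖ • u = y := by
  by_cases h : y = 0
  · obtain ⟨u, hu⟩ := exists_norm_eq E (zero_le_one (α := ℝ))
    exact ⟨u, hu, by simp [h]⟩
  · have : ‖y‖ ≠ 0 := by simpa using h
    refine ⟨‖y‖⁻¹ • y, ?_, ?_⟩
    · rw [norm_smul, norm_inv, norm_norm, inv_mul_cancel₀ this]
    · rw [smul_smul, mul_inv_cancel₀ this, one_smul]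

lemma mem_sq_closedBall (q : ℝ × ℝ) :
    q ∈ closedBall sqCenter (1 / 2) ↔ (0 ≤ q.1 ∧ q.1 ≤ 1) ∧ (0 ≤ q.2 ∧ q.2 ≤ 1) := by
  rw [mem_closedBall, Prod.dist_eq, max_le_iff, Real.dist_eq, Real.dist_eq, abs_le, abs_le]
  simp only [sqCenter]
  constructor
  · rintro ⟨⟨h1, h2⟩, h3, h4⟩; refine ⟨⟨?_, ?_⟩, ?_, ?_⟩ <;> linarith
  · rintro ⟨⟨h1, h2⟩, h3, h4⟩; refine ⟨⟨?_, ?_⟩, ?_, ?_⟩ <;> linarith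

lemma mem_sq_ball (q : ℝ × ℝ) :
    q ∈ ball sqCenter (1 / 2) ↔ (0 < q.1 ∧ q.1 < 1) ∧ (0 < q.2 ∧ q.2 < 1) := by
  rw [mem_ball, Prod.dist_eq, max_lt_iff, Real.dist_eq, Real.dist_eq, abs_lt, abs_lt]
  simp only [sqCenter]
  constructor
  · rintro ⟨⟨h1, h2⟩, h3, h4⟩; refine ⟨⟨?_, ?_⟩, ?_, ?_⟩ <;> linarith
  · rintro ⟨⟨h1, h2⟩, h3, h4⟩; refine ⟨⟨?_, ?_⟩, ?_, ?_⟩ <;> linarith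

lemma tube_norm {f R : ℝ → ℝ} (hf0 : ∀ x, 0 ≤ f x) (hR : ∀ x, 1 ≤ R x)
    {x s : ℝ} (hs0 : 0 ≤ s) (hs1 : s ≤ 1) {u : E} (hu : ‖u‖ = 1) :
    ‖((1 - s) * f x + s * R x) • u‖ = (1 - s) * f x + s * R x := by
  rw [norm_smul, hu, mul_one, Real.norm_of_nonneg]
  have := hf0 x
  have := hR x
  have : 0 ≤ 1 - s := by linarith
  positivity

lemma tube_image [Nontrivial E] {f R : ℝ → ℝ} (hf0 : ∀ x, 0 ≤ f x) (hf1 : ∀ x, f x ≤ 1 / 2)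
    (hR : ∀ x, 1 ≤ R x) :
    tubeMap f R '' (closedBall sqCenter (1 / 2) ×ˢ sphere (0 : E) 1) = tubeSet E f R := by
  ext ⟨x, y⟩
  constructor
  · rintro ⟨⟨⟨x', s⟩, u⟩, ⟨h1, h2⟩, h⟩
    rw [mem_sq_closedBall] at h1
    obtain ⟨⟨h1a, h1b⟩, h1c, h1d⟩ := h1
    have hu : ‖u‖ = 1 := by simpa using h2
    simp only [tubeMap, Prod.mk.injEq] at h h1a h1b h1c h1d
    obtain ⟨rfl, rfl⟩ := h
    have hn := tube_norm (x := x') hf0 hR h1c h1d hu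
    have := hf1 x'
    have := hR x'
    refine ⟨h1a, h1b, ?_, ?_⟩
    · simp only [hn]; nlinarith
    · simp only [hn]; nlinarith
  · rintro ⟨h1, h2, h3, h4⟩
    simp only at h1 h2 h3 h4
    obtain ⟨u, hu, huy⟩ := polar y
    have a1 := hf1 x
    have a2 := hR x
    have hd : 0 < R x - f x := by linarith
    refine ⟨((x, (‖y‖ - f x) / (R x - f x)), u), ⟨?_, by simpa using hu⟩, ?_⟩
    · rw [mem_sq_closedBall]
      refine ⟨⟨h1, h2⟩, ?_, ?_⟩
      · exact div_nonneg (by linarith) hd.le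
      · simp only; rw [div_le_one hd]; linarith
    · simp only [tubeMap, Prod.mk.injEq, true_and]
      rw [← huy]
      congr 1
      rw [huy]
      field_simp
      ring

lemma tube_isClosed {f R : ℝ → ℝ} (hf : Continuous f) (hRc : Continuous R) :
    IsClosed (tubeSet E f R) := by
  have h1 : IsClosed {p : ℝ × E | 0 ≤ p.1} := isClosed_le (by fun_prop) (by fun_prop)
  have h2 : IsClosed {p : ℝ × E | p.1 ≤ 1} := isClosed_le (by fun_prop) (by fun_prop)
  have h3 : IsClosed {p : ℝ × E | f p.1 ≤ ‖p.2‖} := isClosed_le (by fun_prop) (by fun_prop)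
  have h4 : IsClosed {p : ℝ × E | ‖p.2‖ ≤ R p.1} := isClosed_le (by fun_prop) (by fun_prop)
  exact h1.inter (h2.inter (h3.inter h4))

lemma tubeMap_continuous {f R : ℝ → ℝ} (hf : Continuous f) (hRc : Continuous R) :
    Continuous (tubeMap (E := E) f R) := by
  unfold tubeMap; fun_prop

lemma path_interior {Y : Type*} [TopologicalSpace Y] {A : Set Y} {γ : ℝ → Y}
    (hγ : Continuous γ) (h : γ 0 ∈ interior A) : ∃ ε : ℝ, 0 < ε ∧ ε < 1 ∧ γ ε ∈ A := by
  have h1 : ∀ᶠ e in 𝓝 (0 : ℝ), γ e ∈ A :=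
    (hγ.tendsto 0).eventually (mem_interior_iff_mem_nhds.1 h)
  have h2 : ∀ᶠ e in 𝓝[>] (0 : ℝ), γ e ∈ A := h1.filter_mono nhdsWithin_le_nhds
  have h3 : ∀ᶠ e in 𝓝[>] (0 : ℝ), e ∈ Ioo (0 : ℝ) 1 := Ioo_mem_nhdsGT one_pos
  obtain ⟨e, he, he'⟩ := (h2.and h3).exists
  exact ⟨e, he'.1, he'.2, he⟩

lemma tube_not_interior {f R : ℝ → ℝ} (hR : ∀ x, 1 ≤ R x) {p : ℝ × E}
    (hp : p.1 = 0 ∨ p.1 = 1 ∨ ‖p.2‖ = R p.1 ∨ (‖p.2‖ = f p.1 ∧ 0 < f p.1)) :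
    p ∉ interior (tubeSet E f R) := by
  intro hi
  obtain ⟨x, y⟩ := p
  simp only at hp
  rcases hp with rfl | rfl | h | ⟨h, h0⟩
  · obtain ⟨e, he, he1, hA⟩ := path_interior (γ := fun e : ℝ => ((-e, y) : ℝ × E))
      (by fun_prop) (by simpa using hi)
    have := hA.1
    simp only at this
    linarith
  · obtain ⟨e, he, he1, hA⟩ := path_interior (γ := fun e : ℝ => ((1 + e, y) : ℝ × E))
      (by fun_prop) (by simpa using hi)
    have := hA.2.1
    simp only at this
    linarith
  · obtain ⟨e, he, he1, hA⟩ := path_interior (γ := fun e : ℝ => ((x, (1 + e) • y) : ℝ × E))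
      (by fun_prop) (by simpa using hi)
    have := hA.2.2.2
    simp only at this
    rw [norm_smul, Real.norm_of_nonneg (by linarith), h] at this
    have := hR x
    nlinarith
  · obtain ⟨e, he, he1, hA⟩ := path_interior (γ := fun e : ℝ => ((x, (1 - e) • y) : ℝ × E))
      (by fun_prop) (by simpa using hi)
    have := hA.2.2.1
    simp only at this
    rw [norm_smul, Real.norm_of_nonneg (by linarith), h] at this
    nlinarith

lemma tube_interior_subset {f R : ℝ → ℝ} (hf : Continuous f) (hRc : Continuous R)
    {p : ℝ × E} (h1 : 0 < p.1) (h2 : p.1 < 1) (h3 : f p.1 < ‖p.2‖) (h4 : ‖p.2‖ < R p.1) :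
    p ∈ interior (tubeSet E f R) := by
  have hO : IsOpen {p : ℝ × E | 0 < p.1 ∧ p.1 < 1 ∧ f p.1 < ‖p.2‖ ∧ ‖p.2‖ < R p.1} := by
    have h1 : IsOpen {p : ℝ × E | 0 < p.1} := isOpen_lt (by fun_prop) (by fun_prop)
    have h2 : IsOpen {p : ℝ × E | p.1 < 1} := isOpen_lt (by fun_prop) (by fun_prop)
    have h3 : IsOpen {p : ℝ × E | f p.1 < ‖p.2‖} := isOpen_lt (by fun_prop) (by fun_prop)
    have h4 : IsOpen {p : ℝ × E | ‖p.2‖ < R p.1} := isOpen_lt (by fun_prop) (by fun_prop)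
    exact h1.inter (h2.inter (h3.inter h4))
  refine mem_interior.2 ⟨_, ?_, hO, ⟨h1, h2, h3, h4⟩⟩
  rintro q ⟨a, b, c, d⟩
  exact ⟨a.le, b.le, c.le, d.le⟩

/-- Images of `S × sphere` are connected as soon as all sheets contain the same point. -/
lemma tube_image_connected [Nontrivial E] {f R : ℝ → ℝ} (hf : Continuous f) (hRc : Continuous R)
    (hf1 : f 1 = 0) {S : Set (ℝ × ℝ)} (hS : IsConnected S) (h10 : ((1 : ℝ), (0 : ℝ)) ∈ S) :
    IsConnected (tubeMap f R '' (S ×ˢ sphere (0 : E) 1)) := by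
  have hpt : ∀ u : E, tubeMap f R (((1 : ℝ), (0 : ℝ)), u) = ((1 : ℝ), (0 : E)) := by
    intro u; simp [tubeMap, hf1]
  obtain ⟨u0, hu0⟩ := exists_norm_eq E (zero_le_one (α := ℝ))
  refine ⟨⟨_, ⟨((1, 0), u0), ⟨h10, by simpa using hu0⟩, rfl⟩⟩, ?_⟩
  refine isPreconnected_of_forall ((1 : ℝ), (0 : E)) ?_
  rintro _ ⟨⟨q, u⟩, ⟨hq, hu⟩, rfl⟩
  refine ⟨(fun q => tubeMap f R (q, u)) '' S, ?_, ⟨_, h10, hpt u⟩, ⟨q, hq, rfl⟩, ?_⟩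
  · rintro _ ⟨q', hq', rfl⟩
    exact ⟨(q', u), ⟨hq', hu⟩, rfl⟩
  · have := tubeMap_continuous (E := E) hf hRc
    exact hS.isPreconnected.image _ (by fun_prop)

lemma tube_connected [Nontrivial E] {f R : ℝ → ℝ} (hf : Continuous f) (hRc : Continuous R)
    (hf0 : ∀ x, 0 ≤ f x) (hf1 : ∀ x, f x ≤ 1 / 2)
    (hR : ∀ x, 1 ≤ R x) (h1 : f 1 = 0) : IsConnected (tubeSet E f R) := by
  rw [← tube_image hf0 hf1 hR]
  refine tube_image_connected hf hRc h1 ?_ ((mem_sq_closedBall _).2 (by norm_num))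
  exact ⟨⟨sqCenter, by simp⟩, (convex_closedBall _ _).isPreconnected⟩

lemma tube_frontier_connected [Nontrivial E] {f R : ℝ → ℝ} (hf : Continuous f)
    (hRc : Continuous R) (hf0 : ∀ x, 0 ≤ f x) (hf1 : ∀ x, f x ≤ 1 / 2)
    (hR : ∀ x, 1 ≤ R x) (h1 : f 1 = 0) (hpos : ∀ x, 0 ≤ x → x < 1 → 0 < f x) :
    IsConnected (frontier (tubeSet E f R)) := by
  have hsph : ∀ q : ℝ × ℝ, q ∈ sphere sqCenter (1 / 2) ↔
      q ∈ closedBall sqCenter (1 / 2) ∧ q ∉ ball sqCenter (1 / 2) := by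
    intro q
    rw [mem_sphere, mem_closedBall, mem_ball, not_lt]
    exact le_antisymm_iff
  have key : frontier (tubeSet E f R) =
      tubeMap f R '' (sphere sqCenter (1 / 2) ×ˢ sphere (0 : E) 1) := by
    rw [(tube_isClosed hf hRc).frontier_eq]
    ext p
    constructor
    · rintro ⟨hp, hpi⟩
      rw [← tube_image hf0 hf1 hR] at hp
      obtain ⟨⟨⟨x, s⟩, u⟩, ⟨hq, hu⟩, rfl⟩ := hp
      refine ⟨((x, s), u), ⟨(hsph _).2 ⟨hq, fun hb => hpi ?_⟩, hu⟩, rfl⟩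
      obtain ⟨⟨b1, b2⟩, b3, b4⟩ := (mem_sq_ball _).1 hb
      simp only at b1 b2 b3 b4
      have hu' : ‖u‖ = 1 := by simpa using hu
      have hn := tube_norm (x := x) hf0 hR b3.le b4.le hu'
      have := hf1 x
      have := hR x
      refine tube_interior_subset hf hRc b1 b2 ?_ ?_
      · simp only [tubeMap, hn]; nlinarith
      · simp only [tubeMap, hn]; nlinarith
    · rintro ⟨⟨⟨x, s⟩, u⟩, ⟨hq, hu⟩, rfl⟩
      obtain ⟨hq1, hq2⟩ := (hsph _).1 hq
      refine ⟨?_, ?_⟩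
      · rw [← tube_image hf0 hf1 hR]
        exact ⟨_, ⟨hq1, hu⟩, rfl⟩
      · obtain ⟨⟨b1, b2⟩, b3, b4⟩ := (mem_sq_closedBall _).1 hq1
        simp only at b1 b2 b3 b4
        have hu' : ‖u‖ = 1 := by simpa using hu
        have hn := tube_norm (x := x) hf0 hR b3 b4 hu'
        apply tube_not_interior hR
        simp only [tubeMap, hn]
        by_cases c1 : x = 0
        · exact Or.inl c1
        by_cases c2 : x = 1
        · exact Or.inr (Or.inl c2)
        have c1' : 0 < x := lt_of_le_of_ne b1 (Ne.symm c1)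
        have c2' : x < 1 := lt_of_le_of_ne b2 c2
        by_cases c3 : s = 0
        · right; right; right
          refine ⟨by simp [c3], hpos x b1 c2'⟩
        by_cases c4 : s = 1
        · right; right; left
          simp [c4]
        exact absurd ((mem_sq_ball _).2
          ⟨⟨c1', c2'⟩, lt_of_le_of_ne b3 (Ne.symm c3), lt_of_le_of_ne b4 c4⟩) hq2
  rw [key]
  refine tube_image_connected hf hRc h1 ?_ ?_
  · exact isConnected_sphere (by simp [one_add_one_eq_two]) _ (by norm_num)
  · rw [hsph, mem_sq_closedBall, mem_sq_ball]
    norm_num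

lemma tube_frontier_disconnected [Nontrivial E] {f R : ℝ → ℝ} (hf : Continuous f)
    (hRc : Continuous R) (hf0 : ∀ x, 0 ≤ f x) (hf1 : ∀ x, f x ≤ 1 / 2)
    (hR : ∀ x, 1 ≤ R x) {a a' m b b' : ℝ} (ha : 0 < a) (haa : a < a') (ham : a' < m) (hmb : m < b)
    (hbb : b < b') (hb1 : b' < 1) (hza : ∀ x ∈ Icc a a', f x = 0) (hzb : ∀ x ∈ Icc b b', f x = 0)
    (hm : 0 < f m) :
    ¬ IsConnected (frontier (tubeSet E f R)) := by
  intro hc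
  have hfr := (tube_isClosed (E := E) hf hRc).frontier_eq
  obtain ⟨u, hu⟩ := exists_norm_eq E (zero_le_one (α := ℝ))
  have hz : ∀ c c' : ℝ, 0 < c → c' < 1 → (∀ x ∈ Icc c c', f x = 0) → ∀ p : ℝ × E, c < p.1 →
      p.1 < c' → ‖p.2‖ < 1 → p ∈ interior (tubeSet E f R) := by
    intro c c' hc0 hc1 hz p h1 h2 h3
    have hO : IsOpen (Ioo c c' ×ˢ ball (0 : E) 1) := isOpen_Ioo.prod isOpen_ball
    refine mem_interior.2 ⟨_, ?_, hO, ⟨⟨h1, h2⟩, by simpa using h3⟩⟩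
    rintro ⟨x, y⟩ ⟨⟨k1, k2⟩, k3⟩
    have k4 : ‖y‖ < 1 := by simpa using k3
    simp only at k1 k2
    refine ⟨by simp only; linarith, by simp only; linarith, ?_, ?_⟩
    · simp only [hz x ⟨k1.le, k2.le⟩]; exact norm_nonneg _
    · exact k4.le.trans (hR x)
  set W : Set (ℝ × E) := Ioo ((a + a') / 2) ((b + b') / 2) ×ˢ ball (0 : E) (3 / 4) with hW
  have hWo : IsOpen W := isOpen_Ioo.prod isOpen_ball
  have hsub : frontier (tubeSet E f R) ⊆ W := by
    refine hc.isPreconnected.subset_of_closure_inter_subset hWo ?_ ?_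
    · refine ⟨(m, f m • u), ?_, ⟨⟨by simp only; linarith, by simp only; linarith⟩, ?_⟩⟩
      · have hn : ‖f m • u‖ = f m := by
          rw [norm_smul, hu, mul_one, Real.norm_of_nonneg hm.le]
        rw [hfr]
        refine ⟨⟨by simp only; linarith, by simp only; linarith, ?_, ?_⟩, ?_⟩
        · simp only [hn]; exact le_rfl
        · simp only [hn]; linarith [hf1 m, hR m]
        · exact tube_not_interior hR (Or.inr (Or.inr (Or.inr ⟨hn, hm⟩)))
      · have := hf1 m
        simp only [mem_ball_zero_iff, norm_smul, hu, mul_one, Real.norm_of_nonneg hm.le]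
        linarith
    · rintro ⟨x, y⟩ ⟨hcl, hF⟩
      rw [hfr] at hF
      rw [hW, closure_prod_eq, closure_Ioo (by linarith)] at hcl
      obtain ⟨⟨k1, k2⟩, k3⟩ := hcl
      have k4 : ‖y‖ ≤ 3 / 4 := by simpa using closure_ball_subset_closedBall k3
      simp only at k1 k2
      have hni := hF.2
      refine ⟨⟨?_, ?_⟩, ?_⟩
      · refine lt_of_le_of_ne k1 fun h => hni ?_
        refine hz a a' ha (by linarith) hza _ ?_ ?_ ?_ <;> simp only <;> linarith
      · refine lt_of_le_of_ne k2 fun h => hni ?_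
        refine hz b b' (by linarith) hb1 hzb _ ?_ ?_ ?_ <;> simp only <;> linarith
      · rw [mem_ball_zero_iff]
        refine lt_of_le_of_ne k4 fun h => hni ?_
        have := hf1 x
        have := hR x
        refine tube_interior_subset hf hRc ?_ ?_ ?_ ?_ <;> simp only at h ⊢ <;> linarith
  have hmem : ((0 : ℝ), R 0 • u) ∈ frontier (tubeSet E f R) := by
    have hn : ‖R 0 • u‖ = R 0 := by
      rw [norm_smul, hu, mul_one, Real.norm_of_nonneg (by linarith [hR 0])]
    rw [hfr]
    refine ⟨⟨le_rfl, zero_le_one, ?_, ?_⟩, tube_not_interior hR (Or.inl rfl)⟩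
    · simp only [hn]; linarith [hf1 0, hR 0]
    · simp only [hn]; exact le_rfl
  have := (hsub hmem).1.1
  simp only at this
  linarith

/-- The inner radius function. -/
lemma exists_inner {M : Set Iinf} (hM : IsFsigma M) :
    ∃ f : Iinf → ℝ → ℝ, Continuous (Function.uncurry f) ∧ (∀ t x, 0 ≤ f t x) ∧
      (∀ t x, f t x ≤ 1 / 2) ∧ (∀ t, f t 1 = 0) ∧
      (∀ t ∉ M, ∀ x, 0 ≤ x → x < 1 → 0 < f t x) ∧
      (∀ t ∈ M, ∃ a a' m b b' : ℝ, 0 < a ∧ a < a' ∧ a' < m ∧ m < b ∧ b < b' ∧ b' < 1 ∧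
        (∀ x ∈ Icc a a', f t x = 0) ∧ (∀ x ∈ Icc b b', f t x = 0) ∧ 0 < f t m) := by
  obtain ⟨F, hF, rfl⟩ := hM
  obtain ⟨z, hzm, hz01, hzt⟩ := exists_seq_strictMono_tendsto' (zero_lt_one (α := ℝ))
  let S : ℕ → Set ℝ := fun k => Icc (z (4 * k)) (z (4 * k + 1)) ∪ Icc (z (4 * k + 2)) (z (4 * k + 3))
  let C : Set (Iinf × ℝ) := {p | 1 ≤ p.2 ∨ ∃ k, p.1 ∈ F k ∧ p.2 ∈ S k}
  have hSz : ∀ k, ∀ x ∈ S k, z (4 * k) ≤ x ∧ x ≤ z (4 * k + 3) := by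
    rintro k x (⟨h1, h2⟩ | ⟨h1, h2⟩)
    · exact ⟨h1, h2.trans (hzm.monotone (by omega))⟩
    · exact ⟨le_trans (hzm.monotone (by omega)) h1, h2⟩
  have hS1 : ∀ k, ∀ x ∈ S k, x < 1 := fun k x hx => lt_of_le_of_lt (hSz k x hx).2 (hz01 _).2
  have hSc : ∀ k, IsClosed (S k) := fun k => isClosed_Icc.union isClosed_Icc
  have hC : IsClosed C := by
    have : C = ⋂ m : ℕ, ({p : Iinf × ℝ | z m ≤ p.2} ∪ ⋃ k ∈ Finset.range m, F k ×ˢ S k) := by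
      ext ⟨t, x⟩
      simp only [mem_iInter]
      constructor
      · rintro (h | ⟨k, hk, hx⟩) m
        · left; exact (hz01 m).2.le.trans h
        · by_cases hkm : k < m
          · right
            exact mem_biUnion (by simpa using hkm) ⟨hk, hx⟩
          · left
            exact le_trans (hzm.monotone (by omega)) (hSz k x hx).1
      · intro h
        by_cases hx : 1 ≤ x
        · exact Or.inl hx
        · obtain ⟨m, hm⟩ := (hzt.eventually (lt_mem_nhds (not_le.1 hx))).exists
          rcases h m with h | h
          · exact absurd h (not_le.2 hm)
          · simp only [mem_iUnion] at h
            obtain ⟨k, _, hk⟩ := h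
            exact Or.inr ⟨k, hk⟩
    rw [this]
    refine isClosed_iInter fun m => IsClosed.union (isClosed_le (by fun_prop) (by fun_prop)) ?_
    exact (Finset.range m).finite_toSet.isClosed_biUnion fun k _ => (hF k).prod (hSc k)
  have hCne : C.Nonempty := ⟨(fun _ => 0, 1), Or.inl le_rfl⟩
  letI : MetricSpace (Iinf × ℝ) := TopologicalSpace.metrizableSpaceMetric (Iinf × ℝ)
  have h0 : ∀ t x, (t, x) ∈ C → min (infDist (t, x) C) (1 / 2) = 0 := by
    intro t x h
    rw [(hC.mem_iff_infDist_zero hCne).1 h]; norm_num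
  have hpos : ∀ t x, (t, x) ∉ C → 0 < min (infDist (t, x) C) (1 / 2) := by
    intro t x h
    exact lt_min ((hC.notMem_iff_infDist_pos hCne).1 h) (by norm_num)
  refine ⟨fun t x => min (infDist (t, x) C) (1 / 2), ?_, ?_, ?_, ?_, ?_, ?_⟩
  · have : Continuous fun p : Iinf × ℝ => min (infDist p C) (1 / 2) :=
      (continuous_infDist_pt C).min continuous_const
    exact this
  · intro t x; exact le_min infDist_nonneg (by norm_num)
  · intro t x; exact min_le_right _ _
  · intro t; exact h0 t 1 (Or.inl le_rfl)
  · intro t ht x hx0 hx1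
    refine hpos t x ?_
    rintro (h | ⟨k, hk, _⟩)
    · exact absurd hx1 (not_lt.2 h)
    · exact ht (mem_iUnion.2 ⟨k, hk⟩)
  · intro t ht
    obtain ⟨k, hk⟩ := mem_iUnion.1 ht
    have l1 : z (4 * k + 1) < z (4 * k + 2) := hzm (by omega)
    refine ⟨z (4 * k), z (4 * k + 1), (z (4 * k + 1) + z (4 * k + 2)) / 2, z (4 * k + 2),
      z (4 * k + 3), (hz01 _).1, hzm (by omega), by linarith, by linarith, hzm (by omega),
      (hz01 _).2, ?_, ?_, ?_⟩
    · intro x hx; exact h0 t x (Or.inr ⟨k, hk, Or.inl hx⟩)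
    · intro x hx; exact h0 t x (Or.inr ⟨k, hk, Or.inr hx⟩)
    · refine hpos t _ ?_
      rintro (h | ⟨j, _, ⟨h1, h2⟩ | ⟨h1, h2⟩⟩) <;> simp only at *
      · linarith [(hz01 (4 * k + 1)).2, (hz01 (4 * k + 2)).2]
      · have e1 : z (4 * j) < z (4 * k + 2) := by linarith
        have e2 : z (4 * k + 1) < z (4 * j + 1) := by linarith
        rw [hzm.lt_iff_lt] at e1 e2
        omega
      · have e1 : z (4 * j + 2) < z (4 * k + 2) := by linarith
        have e2 : z (4 * k + 1) < z (4 * j + 3) := by linarith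
        rw [hzm.lt_iff_lt] at e1 e2
        omega

/-- A bounded-coefficient power series vanishing on `(0, 1]` is zero. -/
lemma coeff_zero (c : ℕ → ℝ) (hc : ∀ k, |c k| ≤ (1 / 2) ^ k)
    (h : ∀ x : ℝ, 0 < x → x ≤ 1 → ∑' k, c k * x ^ k = 0) : ∀ k, c k = 0 := by
  have hgeo : Summable fun k : ℕ => ((1 : ℝ) / 2) ^ k := summable_geometric_two
  intro k
  induction k using Nat.strong_induction_on with
  | _ k ih =>
    have hb : ∀ x : ℝ, 0 < x → x ≤ 1 → |c k| ≤ x * 2 := by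
      intro x hx0 hx1
      have hs : Summable fun i => c i * x ^ i := by
        refine Summable.of_norm_bounded hgeo fun i => ?_
        rw [Real.norm_eq_abs, abs_mul, abs_of_nonneg (pow_nonneg hx0.le i)]
        exact (mul_le_of_le_one_right (abs_nonneg _) (pow_le_one₀ hx0.le hx1)).trans (hc i)
      have h1 := hs.sum_add_tsum_nat_add (k + 1)
      rw [h x hx0 hx1, Finset.sum_range_succ, Finset.sum_eq_zero, zero_add] at h1
      swap
      · intro i hi
        rw [ih i (Finset.mem_range.1 hi), zero_mul]
      have hg : ∀ i, ‖c (i + (k + 1)) * x ^ (i + (k + 1))‖ ≤ (1 / 2) ^ i * x ^ (k + 1) := by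
        intro i
        rw [Real.norm_eq_abs, abs_mul, abs_of_nonneg (pow_nonneg hx0.le _), pow_add x, ← mul_assoc]
        refine mul_le_mul_of_nonneg_right ?_ (by positivity)
        refine (mul_le_of_le_one_right (abs_nonneg _) (pow_le_one₀ hx0.le hx1)).trans ?_
        refine (hc _).trans ?_
        exact pow_le_pow_of_le_one (by norm_num) (by norm_num) (by omega)
      have h2 := tsum_of_norm_bounded (hasSum_geometric_two.mul_right (x ^ (k + 1))) hg
      have h3 : |c k| * x ^ k ≤ 2 * x ^ (k + 1) := by
        have : c k * x ^ k = -∑' i, c (i + (k + 1)) * x ^ (i + (k + 1)) := by linarith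
        rw [← abs_of_nonneg (pow_nonneg hx0.le k), ← abs_mul, this, abs_neg]
        exact h2
      have hxk : 0 < x ^ k := by positivity
      rw [pow_succ] at h3
      nlinarith
    by_contra hne
    have hp : 0 < |c k| := abs_pos.2 hne
    have hmin : 0 < min 1 (|c k| / 4) := lt_min one_pos (by positivity)
    have := hb (min 1 (|c k| / 4)) hmin (min_le_left _ _)
    have := min_le_right 1 (|c k| / 4)
    linarith

/-- The outer radius function. -/
lemma exists_outer :
    ∃ R : Iinf → ℝ → ℝ, Continuous (Function.uncurry R) ∧ (∀ t x, 1 ≤ R t x) ∧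
      ∀ t t', (∀ x, 0 ≤ x → x ≤ 1 → R t x = R t' x) → t = t' := by
  have hgeo : Summable fun k : ℕ => ((1 : ℝ) / 2) ^ k := summable_geometric_two
  let g : ℝ → ℝ := fun x => max 0 (min x 1)
  have hg0 : ∀ x, 0 ≤ g x := fun x => le_max_left _ _
  have hg1 : ∀ x, g x ≤ 1 := fun x => max_le zero_le_one (min_le_right _ _)
  have hgc : Continuous g := by fun_prop
  have hbd : ∀ (k : ℕ) (p : Iinf × ℝ),
      ‖((p.1 k : ℝ) * (1 / 2) ^ k) * g p.2 ^ k‖ ≤ (1 / 2) ^ k := by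
    intro k p
    have e1 := (p.1 k).2.1
    have e2 := (p.1 k).2.2
    have e3 := pow_nonneg (hg0 p.2) k
    have e4 := pow_le_one₀ (n := k) (hg0 p.2) (hg1 p.2)
    rw [Real.norm_of_nonneg (by positivity)]
    refine (mul_le_of_le_one_right (by positivity) e4).trans ?_
    exact mul_le_of_le_one_left (by positivity) e2
  refine ⟨fun t x => 1 + ∑' k : ℕ, ((t k : ℝ) * (1 / 2) ^ k) * g x ^ k, ?_, ?_, ?_⟩
  · have : Continuous fun p : Iinf × ℝ => ∑' k : ℕ, ((p.1 k : ℝ) * (1 / 2) ^ k) * g p.2 ^ k := by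
      refine continuous_tsum (fun k => ?_) hgeo hbd
      fun_prop
    exact continuous_const.add this
  · intro t x
    have : 0 ≤ ∑' k : ℕ, ((t k : ℝ) * (1 / 2) ^ k) * g x ^ k := by
      refine tsum_nonneg fun k => ?_
      have e1 := (t k).2.1
      have e3 := pow_nonneg (hg0 x) k
      positivity
    linarith
  · intro t t' h
    have hz := coeff_zero (fun k => ((t k : ℝ) - t' k) * (1 / 2) ^ k) ?_ ?_
    · funext k
      have := hz k
      simp only [mul_eq_zero] at this
      rcases this with h | h
      · exact Subtype.ext (by linarith)
      · exact absurd h (by positivity)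
    · intro k
      rw [abs_mul, abs_of_nonneg (a := ((1 : ℝ) / 2) ^ k) (by positivity)]
      refine mul_le_of_le_one_left (by positivity) ?_
      rw [abs_le]
      constructor <;> linarith [(t k).2.1, (t k).2.2, (t' k).2.1, (t' k).2.2]
    · intro x hx0 hx1
      have hgx : g x = x := by simp [g, hx0.le, hx1]
      have h1 := h x hx0.le hx1
      have s1 : Summable fun k : ℕ => ((t k : ℝ) * (1 / 2) ^ k) * g x ^ k :=
        Summable.of_norm_bounded hgeo fun k => hbd k (t, x)
      have s2 : Summable fun k : ℕ => ((t' k : ℝ) * (1 / 2) ^ k) * g x ^ k :=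
        Summable.of_norm_bounded hgeo fun k => hbd k (t', x)
      have h2 := s1.tsum_sub s2
      simp only [hgx] at h1 h2
      simp only [sub_mul]
      rw [h2]
      linarith

/-- The general construction, given an open embedding of `ℝ × E`. -/
lemma main_of_embedding {X : Type*} [MetricSpace X] [CompactSpace X] [Nontrivial E]
    [FiniteDimensional ℝ E] {ψ : ℝ × E → X} (hψ : IsOpenEmbedding ψ)
    {M : Set Iinf} (hM : IsFsigma M) :
    ∃ φ : Iinf → ↥(CSet X), IsEmbedding φ ∧
        φ ⁻¹' {A : ↥(CSet X) | (A : Hyper X) ∉ CBSet X} = M := by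
  obtain ⟨f, hfc, hf0, hf1, hf11, hfM, hfM'⟩ := exists_inner hM
  obtain ⟨R, hRc, hR, hRinj⟩ := exists_outer
  have hfc' : ∀ t, Continuous (f t) := fun t => hfc.comp (by fun_prop : Continuous fun x => (t, x))
  have hRc' : ∀ t, Continuous (R t) := fun t => hRc.comp (by fun_prop : Continuous fun x => (t, x))
  haveI : ProperSpace E := FiniteDimensional.proper ℝ E
  let Q : TopologicalSpace.NonemptyCompacts ((ℝ × ℝ) × E) :=
    ⟨⟨closedBall sqCenter (1 / 2) ×ˢ sphere (0 : E) 1,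
      (isCompact_closedBall _ _).prod (isCompact_sphere _ _)⟩, by
      obtain ⟨u, hu⟩ := exists_norm_eq E (zero_le_one (α := ℝ))
      exact ⟨(sqCenter, u), by simp, by simpa using hu⟩⟩
  let g : Iinf → ((ℝ × ℝ) × E) → X := fun t q => ψ (tubeMap (f t) (R t) q)
  have hg : Continuous g.uncurry := by
    refine hψ.continuous.comp ?_
    have a1 : Continuous fun p : Iinf × ((ℝ × ℝ) × E) => f p.1 p.2.1.1 :=
      hfc.comp (by fun_prop : Continuous fun p : Iinf × ((ℝ × ℝ) × E) => (p.1, p.2.1.1))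
    have a2 : Continuous fun p : Iinf × ((ℝ × ℝ) × E) => R p.1 p.2.1.1 :=
      hRc.comp (by fun_prop : Continuous fun p : Iinf × ((ℝ × ℝ) × E) => (p.1, p.2.1.1))
    unfold tubeMap
    fun_prop
  let Φ : Iinf → Hyper X := fun t => Q.map (g t) (by fun_prop)
  have hΦc : Continuous Φ := Continuous.nonemptyCompacts_map' continuous_const hg
  have hΦ : ∀ t, (Φ t : Set X) = ψ '' tubeSet E (f t) (R t) := by
    intro t
    rw [← tube_image (hf0 t) (hf1 t) (hR t), image_image]
    rfl
  have hconn : ∀ t, IsConnected (Φ t : Set X) := by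
    intro t
    rw [hΦ]
    exact (tube_connected (hfc' t) (hRc' t) (hf0 t) (hf1 t) (hR t) (hf11 t)).image _
      hψ.continuous.continuousOn
  have hfront : ∀ t, frontier (Φ t : Set X) = ψ '' frontier (tubeSet E (f t) (R t)) := by
    intro t
    have hcl : IsClosed (Φ t : Set X) := (Φ t).isCompact.isClosed
    have hpre : ψ ⁻¹' (Φ t : Set X) = tubeSet E (f t) (R t) := by
      rw [hΦ, preimage_image_eq _ hψ.injective]
    have h1 := hψ.isOpenMap.preimage_frontier_eq_frontier_preimage hψ.continuous (Φ t : Set X)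
    rw [hpre] at h1
    rw [← h1, image_preimage_eq_of_subset]
    refine hcl.frontier_subset.trans ?_
    rw [hΦ]
    exact image_subset_range _ _
  have hne : ∀ t, (Φ t : Set X) ≠ univ := by
    intro t h
    have : ψ ((2 : ℝ), (0 : E)) ∈ (Φ t : Set X) := by rw [h]; trivial
    rw [hΦ, hψ.injective.mem_set_image] at this
    have := this.2.1
    norm_num at this
  have hsub : ∀ t t', Φ t = Φ t' → ∀ x, 0 ≤ x → x ≤ 1 → R t x ≤ R t' x := by
    intro t t' h x hx0 hx1
    obtain ⟨u, hu⟩ := exists_norm_eq E (zero_le_one (α := ℝ))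
    have hn : ‖R t x • u‖ = R t x := by
      rw [norm_smul, hu, mul_one, Real.norm_of_nonneg (by linarith [hR t x])]
    have h1 : ψ (x, R t x • u) ∈ (Φ t : Set X) := by
      rw [hΦ]
      refine ⟨_, ⟨hx0, hx1, ?_, ?_⟩, rfl⟩
      · simp only [hn]; linarith [hf1 t x, hR t x]
      · simp only [hn]; exact le_rfl
    rw [h, hΦ, hψ.injective.mem_set_image] at h1
    have := h1.2.2.2
    simpa only [hn] using this
  have hinj : Function.Injective Φ := fun t t' h =>
    hRinj t t' fun x h0 h1 => le_antisymm (hsub t t' h x h0 h1) (hsub t' t h.symm x h0 h1)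
  refine ⟨fun t => ⟨Φ t, hconn t⟩, ?_, ?_⟩
  · refine (Continuous.isClosedEmbedding (hΦc.subtype_mk _) ?_).isEmbedding
    intro t t' h
    exact hinj (congrArg Subtype.val h)
  · ext t
    constructor
    · intro h
      by_contra ht
      refine h ⟨hconn t, hne t, ?_⟩
      change IsConnected (frontier (Φ t : Set X))
      rw [hfront]
      exact (tube_frontier_connected (hfc' t) (hRc' t) (hf0 t) (hf1 t) (hR t) (hf11 t)
        (hfM t ht)).image _ hψ.continuous.continuousOn
    · intro ht h
      have h3 : IsConnected (frontier (Φ t : Set X)) := h.2.2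
      rw [hfront] at h3
      replace h3 : IsConnected (frontier (tubeSet E (f t) (R t))) :=
        ⟨h3.nonempty.of_image, hψ.isInducing.isPreconnected_image.1 h3.isPreconnected⟩
      obtain ⟨a, a', m, b, b', k1, k2, k3, k4, k5, k6, k7, k8, k9⟩ := hfM' t ht
      exact tube_frontier_disconnected (hfc' t) (hRc' t) (hf0 t) (hf1 t) (hR t) k1 k2 k3 k4 k5 k6
        k7 k8 k9 h3

end Helpers

/-- If `X` is a nondegenerate unicoherent Peano continuum without free
arcs containing an open subset homeomorphic to `ℝⁿ`, `2 ≤ n < ∞`, then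
`C(X) \ CB(X)` is `F_σ`-universal in `C(X)`. -/
theorem compl_CBSet_Fsigma_universal (X : Type*) [MetricSpace X] [CompactSpace X]
    [ConnectedSpace X] [Nontrivial X] [LocallyConnectedSpace X]
    (huc : Unicoherent X) (hfa : ∀ A : Set X, ¬ IsFreeArc A)
    (n : ℕ) (hn : 2 ≤ n)
    (hU : ∃ U : Set X, IsOpen U ∧ Nonempty (U ≃ₜ (Fin n → ℝ))) :
    ∀ M : Set Iinf, IsFsigma M →
      ∃ φ : Iinf → ↥(CSet X), IsEmbedding φ ∧
        φ ⁻¹' {A : ↥(CSet X) | (A : Hyper X) ∉ CBSet X} = M := by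
  intro M hM
  obtain ⟨U, hUo, ⟨e⟩⟩ := hU
  obtain ⟨m, rfl⟩ : ∃ m, n = m + 1 + 1 := ⟨n - 2, by omega⟩
  let c : (ℝ × (Fin (m + 1) → ℝ)) ≃L[ℝ] (Fin (m + 1 + 1) → ℝ) :=
    Fin.consEquivL ℝ (fun _ => ℝ)
  have hψ : IsOpenEmbedding (fun p : ℝ × (Fin (m + 1) → ℝ) => ((e.symm (c p) : U) : X)) :=
    hUo.isOpenEmbedding_subtypeVal.comp
      (e.symm.isOpenEmbedding.comp c.toHomeomorph.isOpenEmbedding)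
  exact main_of_embedding hψ hM
end
end

section
/- If X is a nondegenerate continuum containing the open cube (−3,3)^n as an open subset, where 2 ≤ n < ∞, then there exists an embedding Θ : I^∞ → C(X) whose values are subcontinua of (−3,3)^n and such that Θ((t_k)) ∈ C(X) \ CB(X) if and only if (t_k) ∈ ∂(I^∞); equivalently, Θ((t_k)) has connected boundary in X if and only if 0 < t_k < 1 for every k. -/
open Set Topology Metric

noncomputable section

namespace ThetaAux

open Filter

variable {m : ℕ}

/-- The ambient Euclidean space with the sup norm. -/
abbrev EE (m : ℕ) := Fin (m + 2) → ℝ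

/-- The first basis vector. -/
def e0 : EE m := Pi.single 0 1

/-- The second basis vector. -/
def e1 : EE m := Pi.single 1 1

/-- Sum of absolute values of all coordinates but the first. -/
def gg (x : EE m) : ℝ := ∑ i : Fin (m + 1), |x i.succ|

lemma gg_cont : Continuous (gg (m := m)) := by
  unfold gg; fun_prop

lemma gg_nonneg (x : EE m) : 0 ≤ gg x := Finset.sum_nonneg fun _ _ => abs_nonneg _

lemma gg_smul (c : ℝ) (x : EE m) : gg (c • x) = |c| * gg x := by
  simp [gg, abs_mul, Finset.mul_sum]

@[simp] lemma e0_zero : (e0 : EE m) 0 = 1 := by simp [e0]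
@[simp] lemma e0_succ (i : Fin (m + 1)) : (e0 : EE m) i.succ = 0 := by simp [e0]
@[simp] lemma e1_zero : (e1 : EE m) 0 = 0 := by simp [e1]
@[simp] lemma norm_e0 : ‖(e0 : EE m)‖ = 1 := by
  rw [e0, Pi.norm_single]; simp
@[simp] lemma norm_e1 : ‖(e1 : EE m)‖ = 1 := by
  rw [e1, Pi.norm_single]; simp

lemma gg_add_e0 (x : EE m) (s : ℝ) : gg (x + s • e0) = gg x := by
  simp [gg]

@[simp] lemma gg_e0 : gg (e0 : EE m) = 0 := by simp [gg]

lemma gg_add_e1 (x : EE m) : ∃ σ : ℝ, ∀ ε : ℝ, 0 ≤ ε → gg (x + (ε * σ) • e1) = gg x + ε := by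
  have key : ∀ c : ℝ, gg (x + c • e1) = |x 1 + c| + ∑ i : Fin m, |x i.succ.succ| := by
    intro c
    rw [gg, Fin.sum_univ_succ]
    congr 1
    · simp [e1]
    · refine Finset.sum_congr rfl fun i _ => ?_
      have : (e1 : EE m) i.succ.succ = 0 := by
        rw [e1, Pi.single_eq_of_ne]
        intro h
        have := congrArg Fin.val h
        simp at this
      simp [this]
  have k0 : gg x = |x 1| + ∑ i : Fin m, |x i.succ.succ| := by
    have := key 0
    simpa using this
  rcases le_total 0 (x 1) with h | h
  · refine ⟨1, fun ε hε => ?_⟩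
    rw [key, k0, abs_of_nonneg h, abs_of_nonneg (by linarith)]; ring
  · refine ⟨-1, fun ε hε => ?_⟩
    rw [key, k0, abs_of_nonpos h, abs_of_nonpos (by linarith)]; ring

lemma gg_smul_e1 (s : ℝ) : gg (s • (e1 : EE m)) = |s| := by
  rw [gg_smul]
  obtain ⟨σ, hσ⟩ := gg_add_e1 (0 : EE m)
  have : gg (e1 : EE m) = 1 := by
    rw [gg, Fin.sum_univ_succ]
    have : ∀ i : Fin m, (e1 : EE m) i.succ.succ = 0 := by
      intro i
      rw [e1, Pi.single_eq_of_ne]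
      intro h
      have := congrArg Fin.val h
      simp at this
    simp [this]
    simp [e1]
  rw [this, mul_one]

lemma eq_zero_of_gg (x : EE m) (h : gg x = 0) (h0 : x 0 = 0) : x = 0 := by
  rw [gg, Finset.sum_eq_zero_iff_of_nonneg (fun _ _ => abs_nonneg _)] at h
  funext i
  refine Fin.cases h0 (fun j => ?_) i
  simpa using h j (Finset.mem_univ _)

/-- A cone with a channel removed. -/
def Kset (m : ℕ) (w : ℝ) : Set (EE m) := {x | x ≠ 0 ∧ w * x 0 ≤ gg x}

lemma Kset_conn {w : ℝ} (hw : 0 ≤ w) : IsConnected (Kset m w) := by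
  rcases hw.eq_or_lt with rfl | hw
  · have : Kset m 0 = {0}ᶜ := by
      ext x; simp [Kset, gg_nonneg]
    rw [this]
    apply isConnected_compl_singleton_of_one_lt_rank
    rw [rank_fin_fun]
    exact_mod_cast (by omega : 1 < m + 2)
  · have hH : IsPreconnected {x : EE m | x 0 < 0} := by
      apply Convex.isPreconnected
      intro x hx y hy a b ha hb hab
      simp only [mem_ofPred_eq, Pi.add_apply, Pi.smul_apply, smul_eq_mul] at *
      rcases ha.eq_or_lt with rfl | ha
      · have : b = 1 := by linarith
        subst this; simpa using hy
      · nlinarith [mul_neg_of_pos_of_neg ha hx]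
    have hHK : {x : EE m | x 0 < 0} ⊆ Kset m w := by
      intro x hx
      refine ⟨?_, ?_⟩
      · rintro rfl; simp at hx
      · have := gg_nonneg x
        have : w * x 0 ≤ 0 := (mul_neg_of_pos_of_neg hw hx).le
        linarith
    refine ⟨⟨-e0, hHK (by simp)⟩, ?_⟩
    apply isPreconnected_of_forall (-e0)
    intro x hx
    refine ⟨{x : EE m | x 0 < 0} ∪ (fun s : ℝ => x + (-s) • e0) '' Ici 0, ?_, ?_, ?_, ?_⟩
    · apply union_subset hHK
      rintro _ ⟨s, hs, rfl⟩
      simp only [mem_Ici] at hs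
      refine ⟨?_, ?_⟩
      · intro h0
        replace h0 : x + (-s) • e0 = 0 := h0
        have h1 : gg x = 0 := by
          rw [← gg_add_e0 x (-s), h0]; simp [gg]
        have h2 := congrFun h0 0
        simp at h2
        have h3 := hx.2
        rw [h1] at h3
        have h4 : x 0 ≤ 0 := by
          by_contra hc
          push Not at hc
          have := mul_pos hw hc
          linarith
        exact hx.1 (eq_zero_of_gg x h1 (by linarith))
      · simp only
        rw [gg_add_e0]
        have := hx.2
        simp
        nlinarith [mul_nonneg hw.le hs]
    · left; simp
    · right; exact ⟨0, by simp, by simp⟩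
    · apply IsPreconnected.union (x + (-(|x 0| + 1)) • e0)
      · simp only [mem_ofPred_eq, Pi.add_apply, Pi.smul_apply, e0_zero, smul_eq_mul]
        have := le_abs_self (x 0)
        linarith
      · exact ⟨|x 0| + 1, by simp; positivity, rfl⟩
      · exact hH
      · apply isPreconnected_Ici.image
        fun_prop

/-- Shell with a channel removed. -/
def cell (m : ℕ) (w a b : ℝ) : Set (EE m) := {x | a ≤ ‖x‖ ∧ ‖x‖ ≤ b ∧ w * x 0 ≤ gg x}

lemma cell_eq {w a b : ℝ} (ha : 0 < a) :
    cell m w a b = (fun p : EE m × ℝ => (p.2 / ‖p.1‖) • p.1) '' (Kset m w ×ˢ Icc a b) := by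
  ext x
  constructor
  · rintro ⟨h1, h2, h3⟩
    have hx : 0 < ‖x‖ := by linarith
    refine ⟨(x, ‖x‖), ⟨⟨norm_pos_iff.1 hx, h3⟩, h1, h2⟩, ?_⟩
    simp [hx.ne']
  · rintro ⟨⟨y, r⟩, ⟨⟨h1, h2⟩, h3, h4⟩, rfl⟩
    simp only at *
    have hy : 0 < ‖y‖ := norm_pos_iff.2 h1
    have hr : 0 < r := by linarith
    have hn : ‖(r / ‖y‖) • y‖ = r := by
      rw [norm_smul, Real.norm_of_nonneg (by positivity)]; field_simp
    refine ⟨by rw [hn]; exact h3, by rw [hn]; exact h4, ?_⟩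
    rw [gg_smul, abs_of_nonneg (by positivity)]
    simp only [Pi.smul_apply, smul_eq_mul]
    have := mul_le_mul_of_nonneg_left h2 (show 0 ≤ r / ‖y‖ by positivity)
    linarith

lemma cell_conn {w a b : ℝ} (hw : 0 ≤ w) (ha : 0 < a) (hab : a ≤ b) :
    IsConnected (cell m w a b) := by
  rw [cell_eq ha]
  apply ((Kset_conn hw).prod (isConnected_Icc hab)).image
  have h1 : ContinuousOn (fun p : EE m × ℝ => p.2 / ‖p.1‖) (Kset m w ×ˢ Icc a b) := by
    apply continuousOn_snd.div continuousOn_fst.norm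
    rintro ⟨x, r⟩ ⟨h, -⟩
    exact norm_ne_zero_iff.2 h.1
  exact h1.smul continuousOn_fst

/-- The boundary of a cell. -/
def FF (m : ℕ) (w a b : ℝ) : Set (EE m) :=
  {x | x ∈ cell m w a b ∧ (‖x‖ = a ∨ ‖x‖ = b ∨ w * x 0 = gg x)}

lemma FF_conn {w a b : ℝ} (hw : 0 < w) (ha : 0 < a) (hab : a ≤ b) :
    IsConnected (FF m w a b) := by
  have hsideEx : ∃ p : EE m, ‖p‖ = 1 ∧ w * p 0 = gg p := by
    obtain ⟨σ, hσ⟩ := gg_add_e1 (e0 : EE m)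
    have h := hσ w hw.le
    set q : EE m := e0 + (w * σ) • e1 with hq
    have hq0 : q 0 = 1 := by simp [hq]
    have hqn : 0 < ‖q‖ := by
      apply norm_pos_iff.2
      intro h; rw [h] at hq0; simp at hq0
    refine ⟨(1 / ‖q‖) • q, ?_, ?_⟩
    · rw [norm_smul, Real.norm_of_nonneg (by positivity)]; field_simp
    · rw [gg_smul, h, abs_of_nonneg (by positivity)]
      simp [hq0]; ring
  have hEq : FF m w a b = ⋃ p : {p : EE m // ‖p‖ = 1 ∧ w * p 0 = gg p},
      ((cell m w a a ∪ (fun r : ℝ => r • (p : EE m)) '' Icc a b) ∪ cell m w b b) := by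
    ext x
    simp only [mem_iUnion, mem_union]
    constructor
    · rintro ⟨⟨h1, h2, h3⟩, h | h | h⟩
      · obtain ⟨p, hp⟩ := hsideEx
        exact ⟨⟨p, hp⟩, .inl (.inl ⟨h.ge, h.le, h3⟩)⟩
      · obtain ⟨p, hp⟩ := hsideEx
        exact ⟨⟨p, hp⟩, .inr ⟨h.ge, h.le, h3⟩⟩
      · have hx : 0 < ‖x‖ := by linarith
        refine ⟨⟨(1 / ‖x‖) • x, ?_, ?_⟩, .inl (.inr ⟨‖x‖, ⟨h1, h2⟩, ?_⟩)⟩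
        · rw [norm_smul, Real.norm_of_nonneg (by positivity)]; field_simp
        · rw [gg_smul, abs_of_nonneg (by positivity), ← h]
          simp only [Pi.smul_apply, smul_eq_mul]; ring
        · simp [smul_smul, hx.ne']
    · rintro ⟨⟨p, hp1, hp2⟩, (⟨h1, h2, h3⟩ | ⟨r, hr, rfl⟩) | ⟨h1, h2, h3⟩⟩
      · exact ⟨⟨h1, h2.trans hab, h3⟩, .inl (le_antisymm h2 h1)⟩
      · have hr0 : 0 < r := lt_of_lt_of_le ha hr.1
        have hn : ‖r • p‖ = r := by rw [norm_smul, hp1, Real.norm_of_nonneg hr0.le, mul_one]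
        have hg : w * (r • p) 0 = gg (r • p) := by
          rw [gg_smul, ← hp2, abs_of_nonneg hr0.le]
          simp only [Pi.smul_apply, smul_eq_mul]; ring
        exact ⟨⟨by rw [hn]; exact hr.1, by rw [hn]; exact hr.2, hg.le⟩, .inr (.inr hg)⟩
      · exact ⟨⟨hab.trans h1, h2, h3⟩, .inr (.inl (le_antisymm h2 h1))⟩
  rw [hEq]
  obtain ⟨z, hz⟩ := (cell_conn (m := m) hw.le ha le_rfl).nonempty
  obtain ⟨p0, hp0⟩ := hsideEx
  have hmem : ∀ (p : EE m), ‖p‖ = 1 → w * p 0 = gg p → ∀ r, 0 < r → r • p ∈ cell m w r r := by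
    intro p h1 h2 r hr
    have hn : ‖r • p‖ = r := by rw [norm_smul, h1, Real.norm_of_nonneg hr.le, mul_one]
    refine ⟨hn.ge, hn.le, ?_⟩
    rw [gg_smul, ← h2, abs_of_nonneg hr.le]
    simp only [Pi.smul_apply, smul_eq_mul]
    linarith
  refine ⟨⟨z, mem_iUnion.2 ⟨⟨p0, hp0⟩, .inl (.inl hz)⟩⟩, ?_⟩
  apply isPreconnected_iUnion
  · exact ⟨z, mem_iInter.2 fun p => .inl (.inl hz)⟩
  · rintro ⟨p, hp1, hp2⟩
    apply IsPreconnected.union (b • p)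
    · exact .inr ⟨b, ⟨hab, le_rfl⟩, rfl⟩
    · exact hmem p hp1 hp2 b (by linarith)
    · apply IsPreconnected.union (a • p)
      · exact hmem p hp1 hp2 a ha
      · exact ⟨a, ⟨le_rfl, hab⟩, rfl⟩
      · exact (cell_conn hw.le ha le_rfl).isPreconnected
      · apply isPreconnected_Icc.image; fun_prop
    · exact (cell_conn hw.le (by linarith) le_rfl).isPreconnected

/-- The scale of the k-th shell. -/
def rad (k : ℕ) : ℝ := (1 / 4) ^ k

lemma rad_pos (k : ℕ) : 0 < rad k := by unfold rad; positivity

lemma rad_succ (k : ℕ) : rad (k + 1) = rad k / 4 := by unfold rad; rw [pow_succ]; ring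

lemma rad_anti {j k : ℕ} (h : j ≤ k) : rad k ≤ rad j := by
  unfold rad
  exact pow_le_pow_of_le_one (by norm_num) (by norm_num) h

lemma rad_lt {j k : ℕ} (h : j < k) : 4 * rad k ≤ rad j := by
  have := rad_anti (Nat.succ_le_of_lt h)
  rw [Nat.succ_eq_add_one, rad_succ] at this
  linarith

lemma rad_zero : rad 0 = 1 := by simp [rad]

lemma rad_tendsto : Tendsto rad atTop (𝓝 0) := by
  unfold rad
  exact tendsto_pow_atTop_nhds_zero_of_lt_one (by norm_num) (by norm_num)

/-- Channel width. -/
def wt (t : Iinf) (k : ℕ) : ℝ := (t k : ℝ) * (1 - t k)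

/-- Inner radius. -/
def ai (t : Iinf) (k : ℕ) : ℝ := rad k * (1 + (t k : ℝ) / 2)

lemma wt_nonneg (t : Iinf) (k : ℕ) : 0 ≤ wt t k :=
  mul_nonneg (t k).2.1 (sub_nonneg.2 (t k).2.2)

lemma ai_ge (t : Iinf) (k : ℕ) : rad k ≤ ai t k := by
  have := mul_nonneg (rad_pos k).le (t k).2.1
  unfold ai; linarith

lemma ai_le (t : Iinf) (k : ℕ) : ai t k ≤ 3 / 2 * rad k := by
  have := mul_le_mul_of_nonneg_left (t k).2.2 (rad_pos k).le
  unfold ai; linarith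

lemma ai_lt (t : Iinf) (k : ℕ) : ai t k < 2 * rad k := by
  have := ai_le t k
  have := rad_pos k
  linarith

lemma ai_pos (t : Iinf) (k : ℕ) : 0 < ai t k := (rad_pos k).trans_le (ai_ge t k)

/-- The k-th shell. -/
def Ck (m : ℕ) (t : Iinf) (k : ℕ) : Set (EE m) := cell m (wt t k) (ai t k) (2 * rad k)

/-- All the shells. -/
def CC (m : ℕ) (t : Iinf) : Set (EE m) := {0} ∪ ⋃ k, Ck m t k

/-- The connecting segment. -/
def LL (m : ℕ) : Set (EE m) := (fun s : ℝ => -(s • e0)) '' Icc 0 2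

/-- The continuum. -/
def AA (m : ℕ) (t : Iinf) : Set (EE m) := CC m t ∪ LL m

lemma wt_cont (k : ℕ) : Continuous fun t : Iinf => wt t k := by unfold wt; fun_prop

lemma ai_cont (k : ℕ) : Continuous fun t : Iinf => ai t k := by unfold ai; fun_prop

lemma annulus_iff {t : Iinf} {k : ℕ} {y : EE m} (h1 : rad k / 2 < ‖y‖) (h2 : ‖y‖ < 4 * rad k) :
    y ∈ CC m t ↔ y ∈ Ck m t k := by
  constructor
  · rintro (h | h)
    · rw [mem_singleton_iff] at h
      subst h
      have := rad_pos k
      simp at h1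
      linarith
    · obtain ⟨j, hj⟩ := mem_iUnion.1 h
      rcases lt_trichotomy j k with hjk | rfl | hjk
      · have := rad_lt hjk
        have := ai_ge t j
        have := hj.1
        linarith
      · exact hj
      · have := rad_lt hjk
        have := hj.2.1
        linarith
  · exact fun h => .inr (mem_iUnion.2 ⟨k, h⟩)

lemma norm_gt_of_ne {x : EE m} (h : x ≠ 0) : ∃ K, 2 * rad K < ‖x‖ := by
  have : Tendsto (fun k => 2 * rad k) atTop (𝓝 0) := by simpa using rad_tendsto.const_mul 2
  exact (this.eventually_lt_const (norm_pos_iff.2 h)).exists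

lemma graph_closed : IsClosed {p : Iinf × EE m | p.2 ∈ CC m p.1} := by
  have : {p : Iinf × EE m | p.2 ∈ CC m p.1} =
      ⋂ K : ℕ, ({p : Iinf × EE m | ‖p.2‖ ≤ 2 * rad K} ∪
        ⋃ k ∈ Finset.range K, {p : Iinf × EE m | p.2 ∈ Ck m p.1 k}) := by
    ext ⟨t, x⟩
    simp only [mem_iInter, mem_union, mem_iUnion, mem_ofPred_eq, Finset.mem_range, exists_prop]
    constructor
    · rintro (h | h) K
      · rw [mem_singleton_iff] at h
        left; rw [h]; simp; exact (rad_pos K).le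
      · obtain ⟨k, hk⟩ := mem_iUnion.1 h
        by_cases hkK : k < K
        · exact .inr ⟨k, hkK, hk⟩
        · left
          have := rad_anti (not_lt.1 hkK)
          have := hk.2.1
          linarith
    · intro h
      by_cases hx : x = 0
      · exact .inl hx
      · obtain ⟨K, hK⟩ := norm_gt_of_ne hx
        rcases h K with h | ⟨k, -, h⟩
        · linarith
        · exact .inr (mem_iUnion.2 ⟨k, h⟩)
  rw [this]
  refine isClosed_iInter fun K => IsClosed.union ?_ ?_
  · exact isClosed_le (by fun_prop) (by fun_prop)
  · refine isClosed_biUnion_finset fun k _ => ?_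
    have e : {p : Iinf × EE m | p.2 ∈ Ck m p.1 k} =
      {p | ai p.1 k ≤ ‖p.2‖} ∩ ({p | ‖p.2‖ ≤ 2 * rad k} ∩ {p | wt p.1 k * p.2 0 ≤ gg p.2}) := rfl
    rw [e]
    have h1 := ai_cont k
    have h2 := wt_cont k
    have h3 := gg_cont (m := m)
    refine (isClosed_le ?_ ?_).inter ((isClosed_le ?_ ?_).inter (isClosed_le ?_ ?_)) <;> fun_prop

lemma CC_closed (t : Iinf) : IsClosed (CC m t) :=
  graph_closed.preimage (show Continuous fun x : EE m => (t, x) by fun_prop)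

lemma LL_compact : IsCompact (LL m) := by
  apply isCompact_Icc.image; fun_prop

lemma LL_conn : IsConnected (LL m) := by
  apply (isConnected_Icc (by norm_num)).image; fun_prop

lemma AA_closed (t : Iinf) : IsClosed (AA m t) := (CC_closed t).union LL_compact.isClosed

lemma AA_norm {t : Iinf} {x : EE m} (h : x ∈ AA m t) : ‖x‖ ≤ 2 := by
  rcases h with (h | h) | ⟨s, hs, rfl⟩
  · rw [mem_singleton_iff] at h
    rw [h]; simp
  · obtain ⟨k, hk⟩ := mem_iUnion.1 h
    have := hk.2.1
    have := rad_anti (Nat.zero_le k)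
    rw [rad_zero] at this
    linarith
  · simp only [norm_neg, norm_smul, norm_e0, mul_one, Real.norm_of_nonneg hs.1]
    exact hs.2

lemma AA_compact (t : Iinf) : IsCompact (AA m t) := by
  apply (isCompact_closedBall (0 : EE m) 2).of_isClosed_subset (AA_closed t)
  intro x hx
  simpa using AA_norm hx

lemma zero_mem_LL : (0 : EE m) ∈ LL m := ⟨0, by simp, by simp⟩

lemma neg_e0_mem_cell {w a b s : ℝ} (hw : 0 ≤ w) (hs : 0 ≤ s) (h1 : a ≤ s) (h2 : s ≤ b) :
    -(s • e0) ∈ cell m w a b := by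
  have hn : ‖-(s • (e0 : EE m))‖ = s := by
    simp [norm_smul, abs_of_nonneg hs]
  refine ⟨by rw [hn]; exact h1, by rw [hn]; exact h2, ?_⟩
  rw [← neg_smul, gg_smul]
  simp
  positivity

lemma AA_conn (t : Iinf) : IsConnected (AA m t) := by
  refine ⟨⟨0, .inr zero_mem_LL⟩, ?_⟩
  have : AA m t = ⋃ k, (LL m ∪ Ck m t k) := by
    ext x
    simp only [mem_iUnion, mem_union]
    constructor
    · rintro ((h | h) | h)
      · rw [mem_singleton_iff] at h
        exact ⟨0, .inl (h ▸ zero_mem_LL)⟩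
      · obtain ⟨k, hk⟩ := mem_iUnion.1 h
        exact ⟨k, .inr hk⟩
      · exact ⟨0, .inl h⟩
    · rintro ⟨k, h | h⟩
      · exact .inr h
      · exact .inl (.inr (mem_iUnion.2 ⟨k, h⟩))
  rw [this]
  apply isPreconnected_iUnion
  · exact ⟨0, mem_iInter.2 fun k => .inl zero_mem_LL⟩
  · intro k
    have h0 := rad_pos k
    apply IsPreconnected.union (-((2 * rad k) • e0))
    · refine ⟨2 * rad k, ⟨by positivity, ?_⟩, rfl⟩
      have := rad_anti (Nat.zero_le k)
      rw [rad_zero] at this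
      linarith
    · exact neg_e0_mem_cell (wt_nonneg t k) (by positivity) (ai_lt t k).le le_rfl
    · exact LL_conn.isPreconnected
    · exact (cell_conn (wt_nonneg t k) (ai_pos t k) (ai_lt t k).le).isPreconnected

lemma mem_closure_path {x v : EE m} {S : Set (EE m)}
    (h : ∀ᶠ ε in 𝓝[>] (0 : ℝ), x + ε • v ∈ S) : x ∈ closure S := by
  have hc : Tendsto (fun ε : ℝ => x + ε • v) (𝓝[>] 0) (𝓝 x) := by
    have : Continuous (fun ε : ℝ => x + ε • v) := by fun_prop
    have := this.tendsto 0
    simp only [zero_smul, add_zero] at this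
    exact this.mono_left nhdsWithin_le_nhds
  exact mem_closure_of_tendsto hc h

lemma path_eventually {x v : EE m} {S : Set (EE m)} (hS : IsOpen S) (hx : x ∈ S) :
    ∀ᶠ ε in 𝓝[>] (0 : ℝ), x + ε • v ∈ S := by
  have hc : Tendsto (fun ε : ℝ => x + ε • v) (𝓝[>] 0) (𝓝 x) := by
    have : Continuous (fun ε : ℝ => x + ε • v) := by fun_prop
    have := this.tendsto 0
    simp only [zero_smul, add_zero] at this
    exact this.mono_left nhdsWithin_le_nhds
  exact hc.eventually (hS.mem_nhds hx)

/-- Strict points of a cell. -/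
def strict (m : ℕ) (w a b : ℝ) : Set (EE m) := {x | a < ‖x‖ ∧ ‖x‖ < b ∧ w * x 0 < gg x}

lemma strict_open (w a b : ℝ) : IsOpen (strict m w a b) := by
  have e : strict m w a b = {x | a < ‖x‖} ∩ ({x | ‖x‖ < b} ∩ {x | w * x 0 < gg x}) := rfl
  rw [e]
  have h3 := gg_cont (m := m)
  refine (isOpen_lt ?_ ?_).inter ((isOpen_lt ?_ ?_).inter (isOpen_lt ?_ ?_)) <;> fun_prop

lemma strict_subset (w a b : ℝ) : strict m w a b ⊆ cell m w a b :=
  fun _ h => ⟨h.1.le, h.2.1.le, h.2.2.le⟩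

lemma cell_subset_closure {w a b : ℝ} (ha : 0 < a) (hab : a < b) :
    cell m w a b ⊆ closure (strict m w a b) := by
  have s1 : cell m w a b ⊆ closure {x | a < ‖x‖ ∧ ‖x‖ < b ∧ w * x 0 ≤ gg x} := by
    rintro x ⟨h1, h2, h3⟩
    have hx : 0 < ‖x‖ := by linarith
    apply mem_closure_path (v := ((a + b) / 2 / ‖x‖ - 1) • x)
    filter_upwards [Ioo_mem_nhdsGT (zero_lt_one' ℝ)] with ε hε
    obtain ⟨e1, e2⟩ := hε
    set c := (1 - ε) + ε * ((a + b) / 2 / ‖x‖) with hc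
    have hc0 : 0 ≤ c := by
      have : 0 ≤ 1 - ε := by linarith
      have : 0 < a + b := by linarith
      positivity
    have hv : x + ε • ((a + b) / 2 / ‖x‖ - 1) • x = c • x := by
      rw [smul_smul, hc]
      module
    have hn : ‖c • x‖ = (1 - ε) * ‖x‖ + ε * ((a + b) / 2) := by
      rw [norm_smul, Real.norm_of_nonneg hc0, hc]
      field_simp
    rw [hv]
    refine ⟨?_, ?_, ?_⟩
    · rw [hn]; nlinarith
    · rw [hn]; nlinarith
    · rw [gg_smul, abs_of_nonneg hc0]
      simp only [Pi.smul_apply, smul_eq_mul]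
      nlinarith [mul_le_mul_of_nonneg_left h3 hc0]
  refine s1.trans (closure_minimal ?_ isClosed_closure)
  rintro x ⟨h1, h2, h3⟩
  obtain ⟨σ, hσ⟩ := gg_add_e1 x
  apply mem_closure_path (v := σ • e1)
  have hop : IsOpen {x : EE m | a < ‖x‖ ∧ ‖x‖ < b} := by
    have e : {x : EE m | a < ‖x‖ ∧ ‖x‖ < b} = {x | a < ‖x‖} ∩ {x | ‖x‖ < b} := rfl
    rw [e]
    refine (isOpen_lt ?_ ?_).inter (isOpen_lt ?_ ?_) <;> fun_prop
  filter_upwards [path_eventually (v := σ • e1) hop ⟨h1, h2⟩, self_mem_nhdsWithin] with ε h4 h5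
  refine ⟨h4.1, h4.2, ?_⟩
  have h5 : 0 < ε := h5
  rw [smul_smul, hσ ε h5.le]
  simp
  linarith

lemma lower_open {V : Set (EE m)} (hV : IsOpen V) : IsOpen {t : Iinf | (AA m t ∩ V).Nonempty} := by
  have : {t : Iinf | (AA m t ∩ V).Nonempty} = {_t : Iinf | (LL m ∩ V).Nonempty} ∪
      ⋃ k, Prod.fst '' ({p : Iinf × EE m | p.2 ∈ strict m (wt p.1 k) (ai p.1 k) (2 * rad k)} ∩
        Prod.snd ⁻¹' V) := by
    ext t
    simp only [mem_union, mem_iUnion, mem_ofPred_eq]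
    constructor
    · rintro ⟨x, (h | h) | h, hx⟩
      · rw [mem_singleton_iff] at h
        exact .inl ⟨x, h ▸ zero_mem_LL, hx⟩
      · obtain ⟨k, hk⟩ := mem_iUnion.1 h
        obtain ⟨y, hy1, hy2⟩ := mem_closure_iff.1
          (cell_subset_closure (ai_pos t k) (ai_lt t k) hk) V hV hx
        exact .inr ⟨k, ⟨(t, y), ⟨hy2, hy1⟩, rfl⟩⟩
      · exact .inl ⟨x, h, hx⟩
    · rintro (⟨x, h, hx⟩ | ⟨k, ⟨t', y⟩, ⟨hy1, hy2⟩, rfl⟩)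
      · exact ⟨x, .inr h, hx⟩
      · exact ⟨y, .inl (.inr (mem_iUnion.2 ⟨k, strict_subset _ _ _ hy1⟩)), hy2⟩
  rw [this]
  refine isOpen_const.union (isOpen_iUnion fun k => isOpenMap_fst _ (IsOpen.inter ?_ ?_))
  · have e : {p : Iinf × EE m | p.2 ∈ strict m (wt p.1 k) (ai p.1 k) (2 * rad k)} =
      {p | ai p.1 k < ‖p.2‖} ∩ ({p | ‖p.2‖ < 2 * rad k} ∩ {p | wt p.1 k * p.2 0 < gg p.2}) := rfl
    rw [e]
    have h1 := ai_cont k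
    have h2 := wt_cont k
    have h3 := gg_cont (m := m)
    refine (isOpen_lt ?_ ?_).inter ((isOpen_lt ?_ ?_).inter (isOpen_lt ?_ ?_)) <;> fun_prop
  · exact hV.preimage continuous_snd

lemma upper_open {V : Set (EE m)} (hV : IsOpen V) : IsOpen {t : Iinf | AA m t ⊆ V} := by
  rw [← isClosed_compl_iff]
  have hcl : IsClosed {p : Iinf × EE m | p.2 ∈ AA m p.1 ∧ p.2 ∉ V} := by
    have e : {p : Iinf × EE m | p.2 ∈ AA m p.1 ∧ p.2 ∉ V} =
      ({p : Iinf × EE m | p.2 ∈ CC m p.1} ∪ Prod.snd ⁻¹' (LL m)) ∩ Prod.snd ⁻¹' Vᶜ := rfl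
    rw [e]
    exact (graph_closed.union (LL_compact.isClosed.preimage continuous_snd)).inter
      (hV.isClosed_compl.preimage continuous_snd)
  have hco : IsCompact {p : Iinf × EE m | p.2 ∈ AA m p.1 ∧ p.2 ∉ V} := by
    apply (isCompact_univ.prod (isCompact_closedBall (0 : EE m) 2)).of_isClosed_subset hcl
    rintro ⟨t, x⟩ ⟨h, -⟩
    exact ⟨mem_univ _, by simpa using AA_norm h⟩
  have : {t : Iinf | AA m t ⊆ V}ᶜ = Prod.fst '' {p : Iinf × EE m | p.2 ∈ AA m p.1 ∧ p.2 ∉ V} := by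
    ext t
    simp [not_subset]
  rw [this]
  exact (hco.image continuous_fst).isClosed

/-- The map into the hyperspace of the Euclidean space. -/
def NA (m : ℕ) (t : Iinf) : TopologicalSpace.NonemptyCompacts (EE m) :=
  ⟨⟨AA m t, AA_compact t⟩, (AA_conn t).nonempty⟩

lemma NA_cont : Continuous (NA m) := by
  refine continuous_induced_rng.2 (continuous_generateFrom_iff.2 ?_)
  rintro _ (⟨V, hV, rfl⟩ | ⟨V, hV, rfl⟩)
  · exact upper_open hV
  · exact lower_open hV

lemma AA_inj_aux {t t' : Iinf} (h : AA m t = AA m t') (k : ℕ) : ¬ ((t k : ℝ) < t' k) := by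
  intro hlt
  have h0 := rad_pos k
  have hai : ai t k < ai t' k := by
    unfold ai
    have := mul_lt_mul_of_pos_left hlt h0
    linarith
  have hp := ai_pos t k
  have hn : ‖ai t k • (e1 : EE m)‖ = ai t k := by
    rw [norm_smul, norm_e1, Real.norm_of_nonneg hp.le, mul_one]
  have hmem : ai t k • (e1 : EE m) ∈ AA m t := by
    refine .inl (.inr (mem_iUnion.2 ⟨k, hn.ge, by rw [hn]; exact (ai_lt t k).le, ?_⟩))
    simpa using gg_nonneg _
  rw [h] at hmem
  have g1 := ai_ge t k
  have g2 := ai_lt t k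
  rcases hmem with hmem | ⟨s, hs, hse⟩
  · rw [annulus_iff (k := k) (by rw [hn]; linarith) (by rw [hn]; linarith)] at hmem
    have := hmem.1
    rw [hn] at this
    linarith
  · have := congrFun hse 1
    simp [e0, e1] at this
    linarith

lemma AA_inj {t t' : Iinf} (h : AA m t = AA m t') : t = t' := by
  funext k
  apply Subtype.ext
  exact le_antisymm (not_lt.1 (AA_inj_aux h.symm k)) (not_lt.1 (AA_inj_aux h k))

lemma LL_dense : Dense (LL m)ᶜ := by
  intro x
  by_cases hx : x ∈ LL m
  · apply mem_closure_path (v := e1)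
    filter_upwards [self_mem_nhdsWithin] with ε hε
    have hε : 0 < ε := hε
    obtain ⟨s, hs, rfl⟩ := hx
    rintro ⟨s', hs', h⟩
    have := congrFun h 1
    simp [e0, e1] at this
    linarith
  · exact subset_closure hx

lemma mem_frontier_iff {t : Iinf} {x : EE m} :
    x ∈ frontier (AA m t) ↔ x ∈ AA m t ∧ x ∈ closure (CC m t)ᶜ := by
  rw [frontier_eq_closure_inter_closure, (AA_closed t).closure_eq, mem_inter_iff]
  have : closure (AA m t)ᶜ = closure (CC m t)ᶜ := by
    apply subset_antisymm
    · exact closure_mono (compl_subset_compl.2 subset_union_left)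
    · apply closure_minimal _ isClosed_closure
      have := LL_dense.open_subset_closure_inter (CC_closed (m := m) t).isOpen_compl
      rwa [← compl_union] at this
  rw [this]

lemma Ck_subset_AA (t : Iinf) (k : ℕ) : Ck m t k ⊆ AA m t :=
  fun _ h => .inl (.inr (mem_iUnion.2 ⟨k, h⟩))

lemma mem_closure_of_path {t : Iinf} {k : ℕ} {x v : EE m} (hx : x ∈ Ck m t k)
    (h : ∀ ε : ℝ, 0 < ε → ε < 1 → x + ε • v ∉ Ck m t k) : x ∈ closure (CC m t)ᶜ := by
  apply mem_closure_path (v := v)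
  have hop : IsOpen {x : EE m | rad k / 2 < ‖x‖ ∧ ‖x‖ < 4 * rad k} := by
    have e : {x : EE m | rad k / 2 < ‖x‖ ∧ ‖x‖ < 4 * rad k} =
      {x | rad k / 2 < ‖x‖} ∩ {x | ‖x‖ < 4 * rad k} := rfl
    rw [e]
    refine (isOpen_lt ?_ ?_).inter (isOpen_lt ?_ ?_) <;> fun_prop
  have h0 := rad_pos k
  have h1 := ai_ge t k
  have hxa : rad k / 2 < ‖x‖ ∧ ‖x‖ < 4 * rad k :=
    ⟨by linarith [hx.1], by linarith [hx.2.1]⟩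
  filter_upwards [path_eventually (v := v) hop hxa, Ioo_mem_nhdsGT (zero_lt_one' ℝ)] with ε h2 h3
  rw [mem_compl_iff, annulus_iff h2.1 h2.2]
  exact h ε h3.1 h3.2

lemma FF_subset (t : Iinf) (k : ℕ) (hw : 0 < wt t k) :
    FF m (wt t k) (ai t k) (2 * rad k) ⊆ frontier (AA m t) := by
  rintro x ⟨hx, h⟩
  have hC : x ∈ Ck m t k := hx
  refine mem_frontier_iff.2 ⟨Ck_subset_AA t k hC, ?_⟩
  have hp := ai_pos t k
  have hr := rad_pos k
  rcases h with h | h | h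
  · apply mem_closure_of_path (v := -x) hC
    intro ε h1 h2 h3
    have e : x + ε • (-x) = (1 - ε) • x := by module
    have := h3.1
    rw [e, norm_smul, Real.norm_of_nonneg (by linarith), h] at this
    nlinarith
  · apply mem_closure_of_path (v := x) hC
    intro ε h1 h2 h3
    have e : x + ε • x = (1 + ε) • x := by module
    have := h3.2.1
    rw [e, norm_smul, Real.norm_of_nonneg (by linarith), h] at this
    nlinarith
  · apply mem_closure_of_path (v := e0) hC
    intro ε h1 h2 h3
    have := h3.2.2
    rw [gg_add_e0, ← h] at this
    simp at this
    nlinarith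

lemma outer_mem (t : Iinf) : -((2 : ℝ) • (e0 : EE m)) ∈ frontier (AA m t) := by
  have hC : -((2 : ℝ) • (e0 : EE m)) ∈ Ck m t 0 := by
    apply neg_e0_mem_cell (wt_nonneg t 0) (by norm_num)
    · have := ai_lt t 0
      rw [rad_zero] at this; linarith
    · rw [rad_zero]; norm_num
  refine mem_frontier_iff.2 ⟨Ck_subset_AA t 0 hC, ?_⟩
  apply mem_closure_of_path (v := -((2 : ℝ) • (e0 : EE m))) hC
  intro ε h1 h2 h3
  have e : -((2 : ℝ) • (e0 : EE m)) + ε • (-((2 : ℝ) • (e0 : EE m))) = (-(1 + ε) * 2) • e0 := by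
    module
  have := h3.2.1
  rw [e, norm_smul, norm_e0, rad_zero, Real.norm_eq_abs, abs_of_neg (by nlinarith)] at this
  linarith

lemma zero_mem_closure {S : Set (EE m)} (h : ∀ k, ∃ x ∈ S, ‖x‖ ≤ 2 * rad k) : 0 ∈ closure S := by
  rw [Metric.mem_closure_iff]
  intro ε hε
  have : Tendsto (fun k => 2 * rad k) atTop (𝓝 0) := by simpa using rad_tendsto.const_mul 2
  obtain ⟨k, hk⟩ := (this.eventually_lt_const hε).exists
  obtain ⟨x, hx, hn⟩ := h k
  refine ⟨x, hx, ?_⟩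
  rw [dist_zero_left]; linarith

lemma norm_neg_e0 {s : ℝ} (hs : 0 ≤ s) : ‖-(s • (e0 : EE m))‖ = s := by
  simp [norm_smul, abs_of_nonneg hs]

lemma gap_notMem {t : Iinf} {k : ℕ} {s : ℝ} (h1 : 2 * rad (k + 1) < s) (h2 : s < ai t k) :
    -(s • (e0 : EE m)) ∉ CC m t := by
  have hr := rad_pos k
  rw [rad_succ] at h1
  have hn := norm_neg_e0 (m := m) (show 0 ≤ s by linarith)
  have := ai_lt t k
  rw [annulus_iff (k := k) (by rw [hn]; linarith) (by rw [hn]; linarith)]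
  intro h
  have := h.1
  rw [hn] at this
  linarith

lemma zero_mem_frontier (t : Iinf) : (0 : EE m) ∈ frontier (AA m t) := by
  refine mem_frontier_iff.2 ⟨.inr zero_mem_LL, ?_⟩
  apply zero_mem_closure
  intro k
  have hr := rad_pos k
  have := ai_ge t k
  refine ⟨-((3 / 4 * rad k) • (e0 : EE m)), gap_notMem (k := k) ?_ ?_, ?_⟩
  · rw [rad_succ]; linarith
  · linarith
  · rw [norm_neg_e0 (by positivity)]; linarith

lemma mem_FF {t : Iinf} {k : ℕ} {x : EE m} (hx : x ∈ Ck m t k) (hc : x ∈ closure (CC m t)ᶜ) :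
    x ∈ FF m (wt t k) (ai t k) (2 * rad k) := by
  refine ⟨hx, ?_⟩
  by_contra hcon
  push Not at hcon
  have hs : x ∈ strict m (wt t k) (ai t k) (2 * rad k) :=
    ⟨lt_of_le_of_ne hx.1 (Ne.symm hcon.1), lt_of_le_of_ne hx.2.1 hcon.2.1,
      lt_of_le_of_ne hx.2.2 hcon.2.2⟩
  obtain ⟨y, hy1, hy2⟩ := mem_closure_iff.1 hc _ (strict_open _ _ _) hs
  exact hy2 (.inr (mem_iUnion.2 ⟨k, strict_subset _ _ _ hy1⟩))

lemma frontier_conn (t : Iinf) (hw : ∀ k, 0 < wt t k) : IsConnected (frontier (AA m t)) := by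
  set D : ℕ → Set (EE m) := fun k => FF m (wt t k) (ai t k) (2 * rad k) ∪
    (fun s : ℝ => -(s • e0)) '' Icc (2 * rad (k + 1)) (ai t k) with hD
  have hle : ∀ k, 2 * rad (k + 1) ≤ ai t k := by
    intro k
    have := ai_ge t k
    have := rad_pos k
    rw [rad_succ]; linarith
  have hFa : ∀ k, -(ai t k • (e0 : EE m)) ∈ FF m (wt t k) (ai t k) (2 * rad k) := fun k =>
    ⟨neg_e0_mem_cell (wt_nonneg t k) (ai_pos t k).le le_rfl (ai_lt t k).le,
      .inl (norm_neg_e0 (ai_pos t k).le)⟩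
  have hFb : ∀ k, -((2 * rad k) • (e0 : EE m)) ∈ FF m (wt t k) (ai t k) (2 * rad k) := fun k =>
    have := rad_pos k
    ⟨neg_e0_mem_cell (wt_nonneg t k) (by positivity) (ai_lt t k).le le_rfl,
      .inr (.inl (norm_neg_e0 (by positivity)))⟩
  have hDc : IsConnected (⋃ k, D k) := by
    apply IsConnected.iUnion_of_chain
    · intro k
      refine ⟨⟨_, .inl (hFa k)⟩, ?_⟩
      apply IsPreconnected.union (-(ai t k • (e0 : EE m)))
      · exact hFa k
      · exact ⟨ai t k, ⟨hle k, le_rfl⟩, rfl⟩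
      · exact (FF_conn (hw k) (ai_pos t k) (ai_lt t k).le).isPreconnected
      · apply isPreconnected_Icc.image; fun_prop
    · intro k
      exact ⟨-((2 * rad (k + 1)) • e0), .inr ⟨_, ⟨le_rfl, hle k⟩, rfl⟩, .inl (hFb (k + 1))⟩
  apply hDc.subset_closure
  · apply iUnion_subset
    intro k
    apply union_subset (FF_subset t k (hw k))
    rintro _ ⟨s, ⟨h1, h2⟩, rfl⟩
    rcases h1.eq_or_lt with rfl | h1
    · exact FF_subset t (k + 1) (hw _) (hFb (k + 1))
    rcases h2.eq_or_lt with rfl | h2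
    · exact FF_subset t k (hw _) (hFa k)
    refine mem_frontier_iff.2 ⟨.inr ⟨s, ⟨?_, ?_⟩, rfl⟩, subset_closure (gap_notMem h1 h2)⟩
    · have := rad_pos (k + 1)
      linarith
    · have := ai_lt t k
      have := rad_anti (Nat.zero_le k)
      rw [rad_zero] at this
      linarith
  · intro x hx
    have hzero : (0 : EE m) ∈ closure (⋃ k, D k) := by
      apply zero_mem_closure
      intro k
      have := rad_pos k
      exact ⟨_, mem_iUnion.2 ⟨k, .inl (hFb k)⟩, (norm_neg_e0 (by positivity)).le⟩
    obtain ⟨hx1, hx2⟩ := mem_frontier_iff.1 hx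
    have hcase : ∀ k, x ∈ Ck m t k → x ∈ closure (⋃ k, D k) := fun k hk =>
      subset_closure (mem_iUnion.2 ⟨k, .inl (mem_FF hk hx2)⟩)
    rcases hx1 with (h | h) | h
    · rw [mem_singleton_iff] at h
      rw [h]; exact hzero
    · obtain ⟨k, hk⟩ := mem_iUnion.1 h
      exact hcase k hk
    · obtain ⟨s, ⟨h1, h2⟩, rfl⟩ := h
      rcases h1.eq_or_lt with rfl | h1
      · simpa using hzero
      · obtain ⟨k, hk1, hk2⟩ := exists_nat_pow_near_of_lt_one (x := s / 2) (y := 1 / 4)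
          (by linarith) (by linarith) (by norm_num) (by norm_num)
        change rad (k + 1) < _ at hk1
        change _ ≤ rad k at hk2
        rcases lt_or_ge s (ai t k) with h3 | h3
        · exact subset_closure (mem_iUnion.2 ⟨k, .inr ⟨s, ⟨by linarith, h3.le⟩, rfl⟩⟩)
        · exact hcase k (neg_e0_mem_cell (wt_nonneg t k) h1.le h3 (by linarith))

lemma frontier_not_conn (t : Iinf) (k : ℕ) (hw : wt t k = 0) :
    ¬ IsPreconnected (frontier (AA m t)) := by
  intro hpre
  have hr := rad_pos k
  have hin : {x : EE m | ai t k < ‖x‖ ∧ ‖x‖ < 2 * rad k} ⊆ CC m t := by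
    rintro x ⟨h1, h2⟩
    refine .inr (mem_iUnion.2 ⟨k, h1.le, h2.le, ?_⟩)
    rw [hw, zero_mul]
    exact gg_nonneg x
  have hop : IsOpen {x : EE m | ai t k < ‖x‖ ∧ ‖x‖ < 2 * rad k} := by
    have e : {x : EE m | ai t k < ‖x‖ ∧ ‖x‖ < 2 * rad k} =
      {x | ai t k < ‖x‖} ∩ {x | ‖x‖ < 2 * rad k} := rfl
    rw [e]
    refine (isOpen_lt ?_ ?_).inter (isOpen_lt ?_ ?_) <;> fun_prop
  have hle := ai_le t k
  have hr0 := rad_anti (Nat.zero_le k)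
  rw [rad_zero] at hr0
  obtain ⟨x, -, h1, h2⟩ := hpre {x | ‖x‖ < 7 / 4 * rad k} {x | 7 / 4 * rad k < ‖x‖}
    (isOpen_lt (by fun_prop) (by fun_prop)) (isOpen_lt (by fun_prop) (by fun_prop))
    (by
      intro x hx
      rcases lt_trichotomy ‖x‖ (7 / 4 * rad k) with h | h | h
      · exact .inl h
      · exfalso
        obtain ⟨y, hy1, hy2⟩ := mem_closure_iff.1 (mem_frontier_iff.1 hx).2 _ hop
          ⟨by rw [h]; linarith, by rw [h]; linarith⟩
        exact hy2 (hin hy1)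
      · exact .inr h)
    ⟨0, zero_mem_frontier t, by simp; linarith⟩
    ⟨_, outer_mem t, by
      change _ < ‖_‖
      rw [norm_neg_e0 (by norm_num)]; linarith⟩
  have h1 : ‖x‖ < 7 / 4 * rad k := h1
  have h2 : 7 / 4 * rad k < ‖x‖ := h2
  linarith

lemma frontier_iff (t : Iinf) : IsConnected (frontier (AA m t)) ↔ t ∈ pseudoInterior := by
  constructor
  · intro h k
    by_contra hcon
    apply frontier_not_conn t k _ h.isPreconnected
    have h1 := (t k).2.1
    have h2 := (t k).2.2
    unfold wt
    rcases h1.eq_or_lt with h1 | h1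
    · rw [← h1]; simp
    · rcases h2.eq_or_lt with h2 | h2
      · rw [h2]; simp
      · exact absurd ⟨h1, h2⟩ hcon
  · intro h
    exact frontier_conn t fun k => mul_pos (h k).1 (sub_pos.2 (h k).2)

end ThetaAux

/-- If `X` is a nondegenerate continuum containing the open cube
`(-3,3)ⁿ` (`2 ≤ n < ∞`) as an open subset, then there is an embedding
`Θ : I^∞ → C(X)`, with values subcontinua of the cube, such that `Θ((t_k))` has
connected boundary iff `(t_k)` lies in the pseudo-interior `(0,1)^∞`. -/
theorem exists_embedding_theta (X : Type*) [MetricSpace X] [CompactSpace X]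
    [ConnectedSpace X] [Nontrivial X] (n : ℕ) (hn : 2 ≤ n) (U : Set X)
    (hUopen : IsOpen U)
    (hUcube : Nonempty (U ≃ₜ (Set.univ.pi fun _ : Fin n => Set.Ioo (-3 : ℝ) 3))) :
    ∃ Θ : Iinf → ↥(CSet X), IsEmbedding Θ ∧
      (∀ t : Iinf, ((Θ t : Hyper X) : Set X) ⊆ U) ∧
      ∀ t : Iinf, ((Θ t : Hyper X) ∈ CBSet X ↔ t ∈ pseudoInterior) := by
  obtain ⟨h⟩ := hUcube
  obtain ⟨m, rfl⟩ : ∃ m, n = m + 2 := ⟨n - 2, by omega⟩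
  set Q : Set (ThetaAux.EE m) := Set.univ.pi fun _ => Set.Ioo (-3 : ℝ) 3 with hQ
  have hQopen : IsOpen Q := isOpen_set_pi Set.finite_univ fun _ _ => isOpen_Ioo
  have hAQ : ∀ t, ThetaAux.AA m t ⊆ Q := by
    intro t x hx i _
    have h1 := ThetaAux.AA_norm hx
    have h2 := norm_le_pi_norm x i
    rw [Real.norm_eq_abs] at h2
    have h3 := abs_le.1 (h2.trans h1)
    exact ⟨by linarith [h3.1], by linarith [h3.2]⟩
  have hval : IsOpenEmbedding (Subtype.val : Q → ThetaAux.EE m) := hQopen.isOpenEmbedding_subtypeVal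
  let j : Q → X := fun q => (h.symm q : X)
  have hj : IsOpenEmbedding j :=
    hUopen.isOpenEmbedding_subtypeVal.comp h.symm.isOpenEmbedding
  -- lift to the open cube
  have himg : ∀ t, (Subtype.val : Q → ThetaAux.EE m) '' (Subtype.val ⁻¹' ThetaAux.AA m t) =
      ThetaAux.AA m t := by
    intro t
    rw [Subtype.image_preimage_coe]
    exact inter_eq_right.2 (hAQ t)
  let B : Iinf → TopologicalSpace.NonemptyCompacts Q := fun t =>
    ⟨⟨Subtype.val ⁻¹' ThetaAux.AA m t, by
      rw [hval.isInducing.isCompact_iff, himg]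
      exact ThetaAux.AA_compact t⟩, by
      obtain ⟨x, hx⟩ := (ThetaAux.AA_conn (m := m) t).nonempty
      exact ⟨⟨x, hAQ t hx⟩, hx⟩⟩
  have hBcoe : ∀ t, (B t : Set Q) = Subtype.val ⁻¹' ThetaAux.AA m t := fun t => rfl
  have hBcont : Continuous B := by
    rw [hval.isEmbedding.nonemptyCompacts_map.continuous_iff]
    have : (TopologicalSpace.NonemptyCompacts.map Subtype.val hval.isEmbedding.continuous) ∘ B =
        ThetaAux.NA m := by
      funext t
      apply SetLike.coe_injective
      exact himg t
    rw [this]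
    exact ThetaAux.NA_cont
  have hBconn : ∀ t, IsConnected (B t : Set Q) := by
    intro t
    refine ⟨(B t).nonempty, ?_⟩
    rw [← hval.isInducing.isPreconnected_image, hBcoe, himg]
    exact (ThetaAux.AA_conn t).isPreconnected
  let Y : Iinf → Hyper X := fun t => (B t).map j hj.continuous
  have hYcoe : ∀ t, (Y t : Set X) = j '' (B t : Set Q) := fun t => rfl
  have hYcont : Continuous Y := hj.continuous.nonemptyCompacts_map.comp hBcont
  have hYconn : ∀ t, IsConnected (Y t : Set X) := fun t =>
    (hBconn t).image j hj.continuous.continuousOn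
  have hYsub : ∀ t, (Y t : Set X) ⊆ U := by
    rintro t _ ⟨q, -, rfl⟩
    exact (h.symm q).2
  have hfr : ∀ t, frontier (Y t : Set X) = j '' (Subtype.val ⁻¹' frontier (ThetaAux.AA m t)) := by
    intro t
    rw [hval.isOpenMap.preimage_frontier_eq_frontier_preimage hval.continuous, ← hBcoe]
    have h1 : j ⁻¹' (Y t : Set X) = B t := by
      rw [hYcoe, preimage_image_eq _ hj.injective]
    rw [← h1, ← hj.isOpenMap.preimage_frontier_eq_frontier_preimage hj.continuous,
      image_preimage_eq_inter_range, eq_comm, inter_eq_left]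
    refine ((Y t).isCompact.isClosed.frontier_subset).trans ?_
    rw [hYcoe]
    exact image_subset_range _ _
  have hfrconn : ∀ t, IsConnected (frontier (Y t : Set X)) ↔
      IsConnected (frontier (ThetaAux.AA m t)) := by
    intro t
    have h2 : (Subtype.val : Q → ThetaAux.EE m) '' (Subtype.val ⁻¹' frontier (ThetaAux.AA m t)) =
        frontier (ThetaAux.AA m t) := by
      rw [Subtype.image_preimage_coe]
      exact inter_eq_right.2 (((ThetaAux.AA_closed t).frontier_subset).trans (hAQ t))
    rw [hfr]
    conv_rhs => rw [← h2]
    unfold IsConnected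
    rw [hj.isInducing.isPreconnected_image, hval.isInducing.isPreconnected_image,
      image_nonempty, image_nonempty]
  refine ⟨fun t => ⟨Y t, hYconn t⟩, ?_, hYsub, ?_⟩
  · refine (Continuous.isClosedEmbedding (hYcont.subtype_mk _) ?_).isEmbedding
    intro t t' htt
    have h1 : Y t = Y t' := congrArg Subtype.val htt
    have h2 : (B t : Set Q) = B t' := by
      apply hj.injective.image_injective
      rw [← hYcoe, ← hYcoe, h1]
    apply ThetaAux.AA_inj (m := m)
    rw [← himg t, ← himg t', ← hBcoe, ← hBcoe, h2]
  · intro t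
    rw [← ThetaAux.frontier_iff (m := m), ← hfrconn]
    refine ⟨fun hh => hh.2.2, fun hh => ⟨hYconn t, ?_, hh⟩⟩
    intro hu
    rw [hu, frontier_univ] at hh
    exact hh.nonempty.ne_empty rfl
end
end
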